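/- Let q be a prime power, F a finite field with exactly q² elements, and σ : F → F the map x ↦ x^q. For n ≥ 1, the number of conjugacy classes of the unitary group GU(n,q) satisfies q^n + q^{n−1} ≤ k(GU(n,q)) ≤ q^n + 16 · q^{n−1}; moreover if q ≥ 3 then k(GU(n,q)) ≤ q^n + 7 · q^{n−1}. -/

import Mathlib

theorem Field.exists_mul_involution_eq {K : Type*} [Field K] [Finite K] (τ : RingAut K)
    (hτ : τ * τ = 1) (hne : τ ≠ 1) (h : K) (hh : τ h = h) : ∃ t, t * τ t = h := by
  classical
  let G := Subgroup.zpowers τ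
  have hmem : ∀ g ∈ G, g = 1 ∨ g = τ := by
    rintro g ⟨k, rfl⟩
    have h2 : τ ^ (2 : ℤ) = 1 := by rw [zpow_two]; exact hτ
    rcases Int.even_or_odd' k with ⟨m, rfl | rfl⟩
    · left; simp [zpow_mul, h2]
    · right; simp [zpow_add, zpow_mul, h2]
  have : Finite (RingAut K) := Finite.of_injective (fun f : RingAut K => (f : K → K))
    DFunLike.coe_injective
  have : Fintype G := Fintype.ofFinite G
  have hG : (Finset.univ : Finset G) = {1, ⟨τ, Subgroup.mem_zpowers τ⟩} := by
    ext ⟨g, hg⟩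
    rcases hmem g hg with rfl | rfl <;> simp
  have hfix : h ∈ FixedPoints.subfield G K := by
    rintro ⟨g, hg⟩
    rcases hmem g hg with rfl | rfl
    · rfl
    · exact hh
  have : FiniteDimensional (FixedPoints.subfield G K) K := inferInstance
  obtain ⟨t, ht⟩ := FiniteField.norm_surjective (FixedPoints.subfield G K) K ⟨h, hfix⟩
  refine ⟨t, ?_⟩
  have key := Algebra.norm_eq_prod_automorphisms (FixedPoints.subfield G K) t
  rw [ht, ← (FixedPoints.toAlgAutMulEquiv G K).toEquiv.prod_comp, hG, Finset.prod_pair] at key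
  · exact key.symm
  · intro h1
    exact hne (congrArg Subtype.val h1).symm

theorem exists_mul_involution_eq_one_add {T : Type*} [CommRing T] (σ : T ≃+* T)
    (hσ : ∀ x, σ (σ x) = x) (c : T) (hc : c + σ c = 1) (k : ℕ) :
    ∀ e : T, σ e = e → e ^ (k + 1) = 0 → ∃ t, t * σ t = 1 + e := by
  induction k with
  | zero =>
    intro e he hk
    exact ⟨1, by simp_all⟩
  | succ k ih =>
    intro e he hk
    have hnil : IsNilpotent e := ⟨_, hk⟩
    have h1 : IsUnit (1 + c * e) := (Commute.isNilpotent_mul_left (Commute.all c e) hnil).isUnit_one_add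
    obtain ⟨u, hu⟩ := h1.mul (h1.map σ)
    have hue : (u : T) = 1 + e + c * σ c * e ^ 2 := by
      rw [hu, map_add, map_mul, map_one, he]
      linear_combination e * hc
    have hσu : σ (u : T) = u := by rw [hu, map_mul, hσ, mul_comm]
    have hσi : σ ((u⁻¹ : Tˣ) : T) = (u⁻¹ : Tˣ) := by
      have h2 : σ ((u⁻¹ : Tˣ) : T) * u = 1 := by
        rw [← hσu, ← map_mul, Units.inv_mul, map_one]
      exact Units.eq_inv_of_mul_eq_one_left ((mul_comm _ _).trans h2)
    obtain ⟨t, ht⟩ := ih (-((u⁻¹ : Tˣ) : T) * (c * σ c) * e ^ 2)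
      (by simp only [map_mul, map_neg, map_pow, hσ, hσi, he]; ring)
      (by
        have : (e ^ 2) ^ (k + 1) = 0 := by
          rw [← pow_mul, show 2 * (k + 1) = (k + 1 + 1) + k by ring, pow_add, hk, zero_mul]
        rw [mul_pow, this, mul_zero])
    refine ⟨(1 + c * e) * t, ?_⟩
    calc (1 + c * e) * t * σ ((1 + c * e) * t)
        = ((1 + c * e) * σ (1 + c * e)) * (t * σ t) := by rw [map_mul]; ring
      _ = u * (1 + -((u⁻¹ : Tˣ) : T) * (c * σ c) * e ^ 2) := by rw [ht, hu]
      _ = u - (u * ((u⁻¹ : Tˣ) : T)) * (c * σ c) * e ^ 2 := by ring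
      _ = 1 + e := by rw [Units.mul_inv, hue]; ring

/-- The norm of a ring involution on a finite commutative ring reaches every invariant unit,
provided that the involution is nontrivial on every residue field. -/
theorem exists_mul_involution_eq {T : Type*} [CommRing T] [Finite T] (σ : T ≃+* T)
    (hσ : ∀ x, σ (σ x) = x) (d : T) (hd : IsUnit (d - σ d)) (h : T) (hh : σ h = h)
    (hu : IsUnit h) : ∃ t, t * σ t = h := by
  classical
  -- an approximate solution modulo the nilradical
  obtain ⟨t, ht⟩ : ∃ t, IsNilpotent (t * σ t - h) := by
    let ι := MaximalSpectrum T
    let s : ι → ι := fun m => ⟨m.1.comap σ, by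
      have := m.2; exact Ideal.comap_isMaximal_of_equiv σ⟩
    have hs : ∀ m, s (s m) = m := fun m => by
      apply MaximalSpectrum.ext
      ext x
      change σ (σ x) ∈ m.1 ↔ x ∈ m.1
      rw [hσ]
    have hsm : ∀ m x, x ∈ (s m).1 ↔ σ x ∈ m.1 := fun m x => Iff.rfl
    have hfixed : ∀ m : ι, s m = m → ∃ y : T, y * σ y - h ∈ m.1 := by
      intro m hm
      have := m.2
      let : Field (T ⧸ m.1) := Ideal.Quotient.field m.1
      have : Finite (T ⧸ m.1) := Finite.of_surjective _ Ideal.Quotient.mk_surjective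
      let τ : RingAut (T ⧸ m.1) := Ideal.quotientEquiv m.1 m.1 σ (by
        have hmem : ∀ x, x ∈ m.1 ↔ σ x ∈ m.1 := fun x => by rw [← hsm, hm]
        refine le_antisymm (fun x hx => ?_) (Ideal.map_le_iff_le_comap.2 fun x hx => (hmem x).1 hx)
        rw [← hσ x]
        exact Ideal.mem_map_of_mem _ ((hmem x).1 hx))
      have hτ : ∀ x : T, τ (Ideal.Quotient.mk _ x) = Ideal.Quotient.mk _ (σ x) := fun x => rfl
      obtain ⟨y, hy⟩ := Field.exists_mul_involution_eq τ (by
          ext x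
          obtain ⟨x, rfl⟩ := Ideal.Quotient.mk_surjective x
          rw [RingAut.mul_apply, hτ, hτ, hσ]; rfl) (by
          intro h1
          have h2 := hτ d
          rw [h1, RingAut.one_apply, Ideal.Quotient.eq] at h2
          exact m.2.ne_top (Ideal.eq_top_of_isUnit_mem _ h2 hd)) (Ideal.Quotient.mk _ h)
          (by rw [hτ, hh])
      obtain ⟨y, rfl⟩ := Ideal.Quotient.mk_surjective y
      refine ⟨y, ?_⟩
      rw [hτ, ← map_mul, Ideal.Quotient.eq] at hy
      exact hy
    choose! y hy using hfixed
    have : Finite ι := inferInstance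
    obtain ⟨f⟩ : Nonempty (LinearOrder ι) := ⟨linearOrderOfSTO WellOrderingRel⟩
    let x : ι → T := fun m => if s m = m then y m else if s m < m then h else 1
    obtain ⟨t, ht⟩ := Ideal.exists_forall_sub_mem_ideal (I := fun m : ι => m.1)
      (fun i j hij => by
        have := i.2
        have := j.2
        exact Ideal.isCoprime_of_isMaximal (fun h => hij (MaximalSpectrum.ext h))) x
    refine ⟨t, ?_⟩
    rw [← mem_nilradical, nilradical_eq_sInf, Submodule.mem_sInf]
    intro (p : Ideal T) hp
    have : Ideal.IsPrime p := hp
    let m : ι := ⟨p, IsArtinianRing.isMaximal_of_isPrime p⟩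
    change t * σ t - h ∈ m.1
    have h1 := ht m
    have h2 := ht (s m)
    rw [hsm, map_sub] at h2
    have h3 : x m * σ (x (s m)) - h ∈ m.1 := by
      rcases lt_trichotomy (s m) m with hlt | heq | hgt
      · have hx1 : x m = h := by simp only [x, if_neg hlt.ne, if_pos hlt]
        have hx2 : x (s m) = 1 := by
          simp only [x, hs, if_neg hlt.ne', if_neg hlt.not_gt]
        simp [hx1, hx2]
      · have hx1 : x m = y m := by simp only [x, if_pos heq]
        rw [heq, hx1]
        exact hy m heq
      · have hx1 : x m = 1 := by simp only [x, if_neg hgt.ne', if_neg hgt.not_gt]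
        have hx2 : x (s m) = h := by
          simp only [x, hs, if_neg hgt.ne, if_pos hgt]
        simp [hx1, hx2, hh]
    have : t * σ t - h = (t - x m) * σ t + x m * (σ t - σ (x (s m)))
      + (x m * σ (x (s m)) - h) := by ring
    rw [this]
    exact m.1.add_mem (m.1.add_mem (m.1.mul_mem_right _ h1) (m.1.mul_mem_left _ h2)) h3
  obtain ⟨u, rfl⟩ := hu
  obtain ⟨c, hc⟩ : ∃ c : T, c + σ c = 1 := by
    obtain ⟨v, hv⟩ := hd
    have hσv : σ (v : T) = -v := by rw [hv, map_sub, hσ]; ring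
    have hσi : σ ((v⁻¹ : Tˣ) : T) = -(v⁻¹ : Tˣ) := by
      have h2 : -σ ((v⁻¹ : Tˣ) : T) * v = 1 := by
        rw [← neg_eq_iff_eq_neg.2 hσv, neg_mul_neg, ← map_mul, Units.inv_mul, map_one]
      exact neg_eq_iff_eq_neg.1 (Units.eq_inv_of_mul_eq_one_left ((mul_comm _ _).trans h2))
    refine ⟨d * (v⁻¹ : Tˣ), ?_⟩
    rw [map_mul, hσi, mul_neg, ← sub_eq_add_neg, ← sub_mul, ← hv, Units.mul_inv]
  have hσi : σ ((u⁻¹ : Tˣ) : T) = (u⁻¹ : Tˣ) := by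
    have h2 : σ ((u⁻¹ : Tˣ) : T) * u = 1 := by
      rw [← hh, ← map_mul, Units.inv_mul, map_one]
    exact Units.eq_inv_of_mul_eq_one_left ((mul_comm _ _).trans h2)
  obtain ⟨k, hk⟩ := ht
  -- `e` is the relative error of the approximate solution `t`, and `1 + e` is a unit
  have hσt : σ (t * σ t) = t * σ t := by rw [map_mul, hσ, mul_comm]
  set e := ((u⁻¹ : Tˣ) : T) * (t * σ t - u) with he
  have hek : e ^ k = 0 := by rw [he, mul_pow, hk, mul_zero]
  have hσe : σ e = e := by rw [he, map_mul, hσi, map_sub, hσt, hh]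
  have hue : (u : T) * (1 + e) = t * σ t := by
    rw [he, mul_add, ← mul_assoc, Units.mul_inv]; ring
  obtain ⟨w, hw⟩ : IsUnit (1 + e) := IsNilpotent.isUnit_one_add ⟨k, hek⟩
  have hσw : σ (w : T) = w := by rw [hw, map_add, map_one, hσe]
  have hσwi : σ ((w⁻¹ : Tˣ) : T) = (w⁻¹ : Tˣ) := by
    have h2 : σ ((w⁻¹ : Tˣ) : T) * w = 1 := by
      rw [← hσw, ← map_mul, Units.inv_mul, map_one]
    exact Units.eq_inv_of_mul_eq_one_left ((mul_comm _ _).trans h2)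
  obtain ⟨r, hr⟩ := exists_mul_involution_eq_one_add σ hσ c hc k (-e * (w⁻¹ : Tˣ))
    (by rw [map_mul, map_neg, hσe, hσwi])
    (by rw [mul_pow, neg_pow, pow_succ e, hek]; ring)
  refine ⟨t * r, ?_⟩
  calc t * r * σ (t * r) = (t * σ t) * (r * σ r) := by rw [map_mul]; ring
    _ = u * (w * (1 + -e * (w⁻¹ : Tˣ))) := by rw [hr, ← hue, hw, mul_assoc]
    _ = u * (w - e * (w * (w⁻¹ : Tˣ))) := by ring
    _ = u := by rw [Units.mul_inv, hw]; ring

open Matrix in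
/-- Every invertible Hermitian matrix `H` over a finite field with nontrivial star has the form
`star Q * Q` with `Q` in the bicommutant of `H`. -/
theorem Matrix.exists_star_mul_self_eq {F : Type*} [Field F] [Finite F] [StarRing F]
    (d : F) (hd : star d ≠ d) {ι : Type*} [Fintype ι] [DecidableEq ι]
    (H : Matrix ι ι F) (hH : star H = H) (hu : IsUnit H) :
    ∃ Q : Matrix ι ι F, (∀ B, Commute H B → Commute Q B) ∧ star Q * Q = H := by
  have hsa : IsSelfAdjoint H := hH
  have hnormal : IsStarNormal H := hsa.isStarNormal
  let T := StarAlgebra.adjoin F {H}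
  have hcomm : IsMulCommutative T := StarAlgebra.isMulCommutative_adjoin_singleton F H
  have hfin : Finite T := inferInstance
  let h : T := ⟨H, StarAlgebra.self_mem_adjoin_singleton F H⟩
  have hunit : IsUnit h := by
    apply IsArtinianRing.isUnit_of_mem_nonZeroDivisors
    rw [mem_nonZeroDivisors_iff_left]
    intro x hx
    have : H * (x : Matrix ι ι F) = 0 := congrArg Subtype.val hx
    exact Subtype.ext ((hu.mul_right_eq_zero).1 this)
  obtain ⟨t, ht⟩ := exists_mul_involution_eq (starRingAut (R := T)) (fun x => star_star x)
    (algebraMap F T d) (by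
      have : algebraMap F T d - starRingAut (algebraMap F T d) = algebraMap F T (d - star d) := by
        rw [map_sub, starRingAut_apply, algebraMap_star_comm]
      rw [this]
      exact (sub_ne_zero.2 hd.symm).isUnit.map _) h (Subtype.ext hH) hunit
  refine ⟨t, ?_, ?_⟩
  · obtain ⟨t, htT⟩ := t
    clear ht
    change ∀ B, Commute H B → Commute t B
    induction htT using StarAlgebra.adjoin_induction with
    | mem x hx =>
      intro B hB
      rw [Set.mem_singleton_iff.1 hx]; exact hB
    | algebraMap r => intro B _; exact Algebra.commutes r B
    | add x y _ _ hx hy => intro B hB; exact (hx B hB).add_left (hy B hB)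
    | mul x y _ _ hx hy => intro B hB; exact (hx B hB).mul_left (hy B hB)
    | star x _ hx =>
      intro B hB
      have := (hx (star B) (by rw [← hH]; exact hB.star_star)).star_star
      rwa [star_star] at this
  · rw [mul_comm] at ht
    exact congrArg Subtype.val ht

/-- Unitary matrices over a finite field that are similar are unitarily similar. -/
theorem Matrix.unitaryGroup_isConj_of_isUnit {F : Type*} [Field F] [Finite F] [StarRing F]
    (d : F) (hd : star d ≠ d) {ι : Type*} [Fintype ι] [DecidableEq ι]
    (A B : Matrix.unitaryGroup ι F) (P : Matrix ι ι F) (hP : IsUnit P)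
    (h : P * A = B * P) : IsConj A B := by
  obtain ⟨A, hA⟩ := A
  obtain ⟨B, hB⟩ := B
  change P * A = B * P at h
  have hA2 := (Matrix.mem_unitaryGroup_iff).1 hA
  have hB1 := (Matrix.mem_unitaryGroup_iff').1 hB
  have h' : star P * B = A * star P := by
    have h1 : star A * star P = star P * star B := by rw [← star_mul, ← star_mul, h]
    calc star P * B = A * star A * star P * B := by rw [hA2, one_mul]
      _ = A * (star P * star B) * B := by rw [← h1]; simp only [mul_assoc]
      _ = A * star P := by simp only [mul_assoc]; rw [hB1, mul_one]
  obtain ⟨Q, hQ, hQH⟩ := Matrix.exists_star_mul_self_eq d hd (star P * P)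
    (by rw [star_mul, star_star]) (hP.star.mul hP)
  have hQA : Q * A = A * Q := hQ A (by
    change star P * P * A = A * (star P * P)
    rw [mul_assoc, h, ← mul_assoc, h', mul_assoc])
  have hQu : IsUnit Q := by
    have h1 : IsUnit (star Q * Q) := hQH ▸ hP.star.mul hP
    rw [Matrix.isUnit_iff_isUnit_det] at h1 ⊢
    rw [Matrix.det_mul] at h1
    exact isUnit_of_mul_isUnit_right h1
  obtain ⟨Q, rfl⟩ := hQu
  have hU : P * (Q⁻¹ : (Matrix ι ι F)ˣ) ∈ Matrix.unitaryGroup ι F := by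
    rw [Matrix.mem_unitaryGroup_iff', star_mul]
    have hs : star ((Q⁻¹ : (Matrix ι ι F)ˣ) : Matrix ι ι F) * star (Q : Matrix ι ι F) = 1 := by
      rw [← star_mul, Units.mul_inv, star_one]
    calc star ((Q⁻¹ : (Matrix ι ι F)ˣ) : Matrix ι ι F) * star P * (P * (Q⁻¹ : (Matrix ι ι F)ˣ))
        = star ((Q⁻¹ : (Matrix ι ι F)ˣ) : Matrix ι ι F) * (star P * P)
          * (Q⁻¹ : (Matrix ι ι F)ˣ) := by simp only [mul_assoc]
      _ = (star ((Q⁻¹ : (Matrix ι ι F)ˣ) : Matrix ι ι F) * star (Q : Matrix ι ι F)) *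
          (Q * (Q⁻¹ : (Matrix ι ι F)ˣ)) := by rw [← hQH]; simp only [mul_assoc]
      _ = 1 := by rw [hs, Units.mul_inv, mul_one]
  rw [isConj_iff]
  refine ⟨⟨_, hU⟩, mul_inv_eq_of_eq_mul (Subtype.ext ?_)⟩
  change P * (Q⁻¹ : (Matrix ι ι F)ˣ) * A = B * (P * (Q⁻¹ : (Matrix ι ι F)ˣ))
  have : ((Q⁻¹ : (Matrix ι ι F)ˣ) : Matrix ι ι F) * A = A * (Q⁻¹ : (Matrix ι ι F)ˣ) := by
    rw [Units.inv_mul_eq_iff_eq_mul, ← mul_assoc, hQA, mul_assoc, Units.mul_inv, mul_one]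
  rw [mul_assoc, this, ← mul_assoc, h, mul_assoc]

section

open Polynomial

/-- A decomposition of an `F[X]`-module into primary cyclic modules with monic primes. -/
structure PrimaryDecomposition.{u, v} (F : Type u) [Field F] (M : Type v) [AddCommGroup M]
    [Module F[X] M] where
  /-- the index type -/
  ι : Type u
  /-- there are finitely many summands -/
  [fintype : Fintype ι]
  /-- the primes -/
  p : ι → F[X]
  /-- the exponents -/
  e : ι → ℕ
  monic : ∀ i, (p i).Monic
  irreducible : ∀ i, Irreducible (p i)
  pos : ∀ i, 0 < e i
  /-- the decomposition -/
  equiv : M ≃ₗ[F[X]] (∀ i, F[X] ⧸ Ideal.span {p i ^ e i})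

attribute [instance] PrimaryDecomposition.fintype

namespace PrimaryDecomposition

theorem exists_of_isTorsion {F : Type*} [Field F] {M : Type*} [AddCommGroup M] [Module F[X] M]
    [Module.Finite F[X] M] (hM : Module.IsTorsion F[X] M) :
    Nonempty (PrimaryDecomposition F M) := by
  classical
  obtain ⟨ι, hι, p, hp, e, ⟨φ⟩⟩ := Module.equiv_directSum_of_isTorsion hM
  have hspan : ∀ i, (Submodule.span F[X] {p i ^ e i}) = Ideal.span {normalize (p i) ^ e i} := by
    intro i
    refine Ideal.span_singleton_eq_span_singleton.2 ?_
    exact (normalize_associated (p i)).symm.pow_pow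
  let φ₁ : M ≃ₗ[F[X]] (∀ i, F[X] ⧸ Ideal.span {normalize (p i) ^ e i}) :=
    φ ≪≫ₗ DirectSum.linearEquivFunOnFintype F[X] ι _ ≪≫ₗ
      LinearEquiv.piCongrRight fun i => Submodule.quotEquivOfEq _ _ (hspan i)
  let r : (∀ i, F[X] ⧸ Ideal.span {normalize (p i) ^ e i}) →ₗ[F[X]]
      (∀ i : {i // 0 < e i}, F[X] ⧸ Ideal.span {normalize (p i) ^ e i}) :=
    LinearMap.pi fun i => LinearMap.proj i.1
  have hr : Function.Bijective r := by
    refine ⟨fun x y hxy => ?_, fun y => ?_⟩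
    · funext i
      by_cases hi : 0 < e i
      · exact congrFun hxy ⟨i, hi⟩
      · have hi0 : e i = 0 := by omega
        have : Subsingleton (F[X] ⧸ Ideal.span {normalize (p i) ^ e i}) := by
          rw [hi0, pow_zero, Ideal.span_singleton_one]
          exact Ideal.Quotient.subsingleton_iff.2 rfl
        exact Subsingleton.elim _ _
    · refine ⟨fun i => if hi : 0 < e i then y ⟨i, hi⟩ else 0, ?_⟩
      funext ⟨i, hi⟩
      exact dif_pos hi
  exact ⟨{
    ι := {i // 0 < e i}
    p := fun i => normalize (p i)
    e := fun i => e i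
    monic := fun i => monic_normalize (hp i).ne_zero
    irreducible := fun i => (normalize_associated (p i)).symm.irreducible (hp i)
    pos := fun i => i.2
    equiv := φ₁ ≪≫ₗ LinearEquiv.ofBijective r hr }⟩

variable {F : Type*} [Field F] {M N : Type*} [AddCommGroup M] [Module F[X] M]
  [AddCommGroup N] [Module F[X] N]

open Classical in
/-- The product of the primes whose exponent is `j`. -/
noncomputable def layer (D : PrimaryDecomposition F M) (j : ℕ) : F[X] :=
  ∏ i with D.e i = j, D.p i

open Classical in
/-- The number of summands of a given type. -/
noncomputable def mult (D : PrimaryDecomposition F M) (p : F[X]) (j : ℕ) : ℕ :=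
  Finset.card {i | D.p i = p ∧ D.e i = j}

open Classical in
theorem normalizedFactors_layer (D : PrimaryDecomposition F M) (j : ℕ) :
    UniqueFactorizationMonoid.normalizedFactors (D.layer j) =
      (Finset.univ.filter fun i => D.e i = j).val.map D.p := by
  rw [layer, Finset.prod, UniqueFactorizationMonoid.normalizedFactors_prod_eq]
  · rw [Multiset.map_map]
    exact Multiset.map_congr rfl fun i _ => (D.monic i).normalize_eq_self
  · intro a ha
    obtain ⟨i, -, rfl⟩ := Multiset.mem_map.1 ha
    exact D.irreducible i

open Classical in
theorem mult_eq_count (D : PrimaryDecomposition F M) (p : F[X]) (j : ℕ) :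
    D.mult p j = (UniqueFactorizationMonoid.normalizedFactors (D.layer j)).count p := by
  rw [normalizedFactors_layer, Multiset.count_map, mult, ← Finset.filter_val, Finset.card,
    Finset.filter_filter]
  congr 2
  ext i
  simp [and_comm, eq_comm]

/-- The layers determine the module. -/
theorem nonempty_linearEquiv_of_layer_eq (D : PrimaryDecomposition F M)
    (E : PrimaryDecomposition F N) (h : ∀ j, 0 < j → D.layer j = E.layer j) :
    Nonempty (M ≃ₗ[F[X]] N) := by
  classical
  have hmult : ∀ p j, D.mult p j = E.mult p j := by
    intro p j
    rcases Nat.eq_zero_or_pos j with rfl | hj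
    · rw [mult, mult, Finset.card_eq_zero.2, Finset.card_eq_zero.2]
      · exact Finset.filter_eq_empty_iff.2 fun i _ hi => (E.pos i).ne' hi.2
      · exact Finset.filter_eq_empty_iff.2 fun i _ hi => (D.pos i).ne' hi.2
    · rw [mult_eq_count, mult_eq_count, h j hj]
  have hfib : ∀ x : F[X] × ℕ,
      Nonempty ({i // (D.p i, D.e i) = x} ≃ {i // (E.p i, E.e i) = x}) := by
    rintro ⟨p, j⟩
    refine ⟨Fintype.equivOfCardEq ?_⟩
    have := hmult p j
    simp only [mult] at this
    simp only [Fintype.card_subtype, Prod.mk.injEq]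
    convert this
  have hfib' := fun x => (hfib x).some
  let s : D.ι ≃ E.ι := (Equiv.sigmaFiberEquiv fun i => (D.p i, D.e i)).symm.trans
    ((Equiv.sigmaCongrRight hfib').trans (Equiv.sigmaFiberEquiv fun i => (E.p i, E.e i)))
  have hs : ∀ i, (E.p (s i), E.e (s i)) = (D.p i, D.e i) := fun i =>
    (hfib' (D.p i, D.e i) ⟨i, rfl⟩).2
  have hI : ∀ i, Ideal.span {D.p i ^ D.e i} = Ideal.span {E.p (s i) ^ E.e (s i)} := by
    intro i
    have := hs i
    rw [Prod.mk.injEq] at this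
    rw [this.1, this.2]
  exact ⟨D.equiv ≪≫ₗ (LinearEquiv.piCongrRight fun i => Submodule.quotEquivOfEq _ _ (hI i)) ≪≫ₗ
    LinearEquiv.piCongrLeft F[X] (fun i => F[X] ⧸ Ideal.span {E.p i ^ E.e i}) s ≪≫ₗ
    E.equiv.symm⟩

theorem card_quotient_span_pow [Finite F] {p : F[X]} (hp : p.Monic) (k : ℕ) :
    Nat.card (F[X] ⧸ Ideal.span {p ^ k}) = Nat.card F ^ (k * p.natDegree) := by
  have hfin : Module.Finite F (F[X] ⧸ Ideal.span {p ^ k}) :=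
    (hp.pow k).finite_quotient
  rw [Module.natCard_eq_pow_finrank (K := F),
    finrank_quotient_span_eq_natDegree, natDegree_pow]

/-- Multiplication by `b` identifies `R ⧸ (a)` with the `a`-torsion of `R ⧸ (a * b)`. -/
theorem card_torsion_quotient_mul {R : Type*} [CommRing R] [IsDomain R] {a b : R}
    (ha : a ≠ 0) (hb : b ≠ 0) :
    Nat.card {x : R ⧸ Ideal.span {a * b} // a • x = 0} = Nat.card (R ⧸ Ideal.span {a}) := by
  let f : R →ₗ[R] (Submodule.torsionBy R (R ⧸ Ideal.span {a * b}) a) :=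
    LinearMap.codRestrict _ ((Submodule.mkQ (Ideal.span {a * b})).comp (LinearMap.mulLeft R b))
      (fun r => by
        rw [Submodule.mem_torsionBy_iff, LinearMap.comp_apply, ← map_smul, Submodule.mkQ_apply,
          Submodule.Quotient.mk_eq_zero, Ideal.mem_span_singleton]
        exact ⟨r, by simp [mul_assoc]⟩)
  have hf : Function.Surjective f := by
    rintro ⟨x, hx⟩
    obtain ⟨x, rfl⟩ := Submodule.Quotient.mk_surjective _ x
    rw [Submodule.mem_torsionBy_iff, ← Submodule.Quotient.mk_smul,
      Submodule.Quotient.mk_eq_zero, Ideal.mem_span_singleton] at hx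
    obtain ⟨y, hy⟩ := hx
    have : x = b * y := mul_left_cancel₀ ha (by rw [← mul_assoc]; exact hy)
    exact ⟨y, Subtype.ext (by simp only [this]; rfl)⟩
  have hk : LinearMap.ker f = Ideal.span {a} := by
    ext r
    rw [LinearMap.mem_ker, ← Subtype.val_inj, Ideal.mem_span_singleton]
    change Submodule.Quotient.mk (b * r) = 0 ↔ _
    rw [Submodule.Quotient.mk_eq_zero, Ideal.mem_span_singleton, mul_comm a,
      mul_dvd_mul_iff_left hb]
  have := (Submodule.quotEquivOfEq _ _ hk).symm ≪≫ₗ f.quotKerEquivOfSurjective hf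
  exact (Nat.card_congr this.toEquiv).symm

theorem card_torsion_quotient_pow [Finite F] {p : F[X]} (hp : p.Monic) (e j : ℕ) :
    Nat.card {x : F[X] ⧸ Ideal.span {p ^ e} // p ^ j • x = 0} =
      Nat.card F ^ (min e j * p.natDegree) := by
  rcases le_total j e with h | h
  · obtain ⟨k, rfl⟩ := Nat.exists_eq_add_of_le h
    rw [pow_add, card_torsion_quotient_mul (hp.pow j).ne_zero (hp.pow k).ne_zero, card_quotient_span_pow hp,
      min_eq_right h]
  · have : ∀ x : F[X] ⧸ Ideal.span {p ^ e}, p ^ j • x = 0 := by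
      intro x
      obtain ⟨x, rfl⟩ := Submodule.Quotient.mk_surjective _ x
      rw [← Submodule.Quotient.mk_smul, Submodule.Quotient.mk_eq_zero, Ideal.mem_span_singleton]
      exact (pow_dvd_pow p h).mul_right x
    rw [min_eq_left h, ← card_quotient_span_pow hp]
    exact Nat.card_congr (Equiv.subtypeUnivEquiv this)

theorem card_torsion_quotient_of_isCoprime {R : Type*} [CommRing R] {a b : R}
    (h : IsCoprime a b) : Nat.card {x : R ⧸ Ideal.span {b} // a • x = 0} = 1 := by
  have : ∀ x : R ⧸ Ideal.span {b}, a • x = 0 → x = 0 := by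
    intro x hx
    obtain ⟨x, rfl⟩ := Submodule.Quotient.mk_surjective _ x
    rw [← Submodule.Quotient.mk_smul, Submodule.Quotient.mk_eq_zero,
      Ideal.mem_span_singleton] at hx
    rw [Submodule.Quotient.mk_eq_zero, Ideal.mem_span_singleton]
    exact h.symm.dvd_of_dvd_mul_left hx
  rw [Nat.card_eq_one_iff_unique]
  exact ⟨⟨fun x y => Subtype.ext ((this _ x.2).trans (this _ y.2).symm)⟩, ⟨0, smul_zero _⟩⟩

open Classical in
theorem card_torsion [Finite F] (D : PrimaryDecomposition F M) {p : F[X]} (hpm : p.Monic)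
    (hp : Irreducible p) (j : ℕ) :
    Nat.card {x : M // p ^ j • x = 0} =
      Nat.card F ^ ((∑ i with D.p i = p, min (D.e i) j) * p.natDegree) := by
  have h1 : {x : M // p ^ j • x = 0} ≃
      {x : ∀ i, F[X] ⧸ Ideal.span {D.p i ^ D.e i} // ∀ i, p ^ j • x i = 0} :=
    D.equiv.toEquiv.subtypeEquiv fun x => by
      rw [← D.equiv.map_eq_zero_iff, map_smul, funext_iff]; rfl
  rw [Nat.card_congr (h1.trans (Equiv.subtypePiEquivPi
    (p := fun i (x : F[X] ⧸ Ideal.span {D.p i ^ D.e i}) => p ^ j • x = 0))), Nat.card_pi, Finset.sum_mul,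
    ← Finset.prod_pow_eq_pow_sum, Finset.prod_filter]
  refine Finset.prod_congr rfl fun i _ => ?_
  split_ifs with h
  · rw [h, card_torsion_quotient_pow hpm]
  · apply card_torsion_quotient_of_isCoprime
    refine IsCoprime.pow ?_
    rw [hp.coprime_iff_not_dvd]
    intro hdvd
    exact h (eq_of_monic_of_associated (D.monic i) hpm
      (hp.associated_of_dvd (D.irreducible i) hdvd).symm)

theorem card_eq [Finite F] (D : PrimaryDecomposition F M) :
    Nat.card M = Nat.card F ^ (∑ i, D.e i * (D.p i).natDegree) := by
  rw [Nat.card_congr D.equiv.toEquiv, Nat.card_pi, ← Finset.prod_pow_eq_pow_sum]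
  exact Finset.prod_congr rfl fun i _ => card_quotient_span_pow (D.monic i) _

open Classical in
theorem two_mul_sum_min (D : PrimaryDecomposition F M) (p : F[X]) (j : ℕ) :
    2 * (∑ i with D.p i = p, min (D.e i) (j + 1)) =
      (∑ i with D.p i = p, min (D.e i) j) + (∑ i with D.p i = p, min (D.e i) (j + 2)) +
        D.mult p (j + 1) := by
  rw [mult, ← Finset.filter_filter, Finset.card_filter, Finset.mul_sum, ← Finset.sum_add_distrib,
    ← Finset.sum_add_distrib]
  refine Finset.sum_congr rfl fun i _ => ?_
  split_ifs <;> omega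

open Classical in
/-- The multiplicities are determined by the sizes of the torsion submodules. -/
theorem mult_eq_of_card_torsion_eq [Finite F] (D : PrimaryDecomposition F M) {p r : F[X]}
    (hpm : p.Monic) (hp : Irreducible p) (hrm : r.Monic) (hr : Irreducible r)
    (hdeg : p.natDegree = r.natDegree)
    (h : ∀ j : ℕ, Nat.card {x : M // p ^ j • x = 0} = Nat.card {x : M // r ^ j • x = 0})
    (j : ℕ) (hj : 0 < j) : D.mult p j = D.mult r j := by
  have h1 : ∀ j, (∑ i with D.p i = p, min (D.e i) j) = ∑ i with D.p i = r, min (D.e i) j := by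
    intro j
    have := h j
    rw [D.card_torsion hpm hp, D.card_torsion hrm hr, ← hdeg] at this
    exact Nat.eq_of_mul_eq_mul_right hp.natDegree_pos
      (Nat.pow_right_injective Finite.one_lt_card this)
  obtain ⟨j, rfl⟩ := Nat.exists_eq_add_of_lt hj
  rw [zero_add]
  have h2 := D.two_mul_sum_min p j
  have h3 := D.two_mul_sum_min r j
  rw [h1, h1, h1] at h2
  omega

end PrimaryDecomposition

section ConjDual

variable {F : Type*} [Field F] [StarRing F]

/-- The monic polynomial whose roots are the `(star r)⁻¹`, with `r` a root of `f`. -/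
noncomputable def conjDual (f : F[X]) : F[X] :=
  C (star (f.coeff 0))⁻¹ * (f.map (starRingEnd F)).reverse

/-- Monic polynomials that agree with their conjugate dual. -/
def IsSelfDual (f : F[X]) : Prop :=
  f.Monic ∧ conjDual f = f

theorem coeff_conjDual (f : F[X]) (k : ℕ) :
    (conjDual f).coeff k = (star (f.coeff 0))⁻¹ * star (f.coeff (revAt f.natDegree k)) := by
  rw [conjDual, coeff_C_mul, coeff_reverse, coeff_map, natDegree_map]
  rfl

theorem conjDual_mul (f g : F[X]) : conjDual (f * g) = conjDual f * conjDual g := by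
  simp only [conjDual, Polynomial.map_mul, reverse_mul_of_domain, mul_coeff_zero, star_mul',
    mul_inv, C_mul]
  ring

theorem conjDual_one : conjDual (1 : F[X]) = 1 := by
  rw [conjDual, Polynomial.map_one, ← C_1, reverse_C]
  simp

theorem conjDual_pow (f : F[X]) (k : ℕ) : conjDual (f ^ k) = conjDual f ^ k := by
  induction k with
  | zero => simp only [pow_zero, conjDual_one]
  | succ k ih => rw [pow_succ, conjDual_mul, ih, pow_succ]

theorem conjDual_prod {ι : Type*} (s : Finset ι) (f : ι → F[X]) :
    conjDual (∏ i ∈ s, f i) = ∏ i ∈ s, conjDual (f i) := by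
  classical
  induction s using Finset.induction_on with
  | empty => simp only [Finset.prod_empty, conjDual_one]
  | insert i s hi ih => rw [Finset.prod_insert hi, conjDual_mul, ih, Finset.prod_insert hi]

theorem natDegree_conjDual {f : F[X]} (h0 : f.coeff 0 ≠ 0) :
    (conjDual f).natDegree = f.natDegree := by
  rw [conjDual, natDegree_C_mul (inv_ne_zero (star_ne_zero.2 h0)), reverse_natDegree,
    natDegree_map, natTrailingDegree_eq_zero_of_constantCoeff_ne_zero, Nat.sub_zero]
  simpa using h0

theorem monic_conjDual {f : F[X]} (h0 : f.coeff 0 ≠ 0) : (conjDual f).Monic := by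
  rw [Monic, leadingCoeff, natDegree_conjDual h0, coeff_conjDual, revAt_le le_rfl, Nat.sub_self,
    inv_mul_cancel₀ (star_ne_zero.2 h0)]

theorem coeff_zero_conjDual {f : F[X]} (hf : f.Monic) :
    (conjDual f).coeff 0 = (star (f.coeff 0))⁻¹ := by
  rw [coeff_conjDual, revAt_le (Nat.zero_le _), Nat.sub_zero, hf.coeff_natDegree, star_one,
    mul_one]

theorem conjDual_conjDual {f : F[X]} (hf : f.Monic) (h0 : f.coeff 0 ≠ 0) :
    conjDual (conjDual f) = f := by
  ext k
  rw [coeff_conjDual, coeff_zero_conjDual hf, natDegree_conjDual h0, coeff_conjDual, revAt_invol]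
  simp only [star_inv₀, star_star, inv_inv, star_mul']
  rw [mul_inv_cancel_left₀ h0]

theorem irreducible_conjDual {f : F[X]} (hf : f.Monic) (h0 : f.coeff 0 ≠ 0)
    (hirr : Irreducible f) : Irreducible (conjDual f) := by
  have hm := monic_conjDual h0
  refine (hm.irreducible_iff_natDegree).2 ⟨fun h => hirr.ne_one ?_, fun g k hg hk hgk => ?_⟩
  · rw [← conjDual_conjDual hf h0, h, conjDual_one]
  · have h0' : (conjDual f).coeff 0 ≠ 0 := by
      rw [coeff_zero_conjDual hf]
      exact inv_ne_zero (star_ne_zero.2 h0)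
    have hne := h0'
    rw [← hgk, mul_coeff_zero] at hne
    have hg0 := left_ne_zero_of_mul hne
    have hk0 := right_ne_zero_of_mul hne
    have := (hf.irreducible_iff_natDegree.1 hirr).2 (conjDual g) (conjDual k)
      (monic_conjDual hg0) (monic_conjDual hk0) (by
        rw [← conjDual_mul, hgk, conjDual_conjDual hf h0])
    rwa [natDegree_conjDual hg0, natDegree_conjDual hk0] at this

theorem IsSelfDual.coeff_zero_ne_zero {f : F[X]} (hf : IsSelfDual f) : f.coeff 0 ≠ 0 := by
  intro h
  have := hf.1
  rw [← hf.2, conjDual, h] at this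
  simp at this

theorem IsSelfDual.mul {f g : F[X]} (hf : IsSelfDual f) (hg : IsSelfDual g) :
    IsSelfDual (f * g) :=
  ⟨hf.1.mul hg.1, by rw [conjDual_mul, hf.2, hg.2]⟩

theorem IsSelfDual.of_mul {f g : F[X]} (hf : IsSelfDual f) (hfg : IsSelfDual (f * g)) :
    IsSelfDual g := by
  refine ⟨hf.1.of_mul_monic_left hfg.1, mul_left_cancel₀ hf.1.ne_zero ?_⟩
  rw [← hfg.2, conjDual_mul, hf.2]

theorem isSelfDual_mul_conjDual {f : F[X]} (hf : f.Monic) (h0 : f.coeff 0 ≠ 0) :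
    IsSelfDual (f * conjDual f) :=
  ⟨hf.mul (monic_conjDual h0), by rw [conjDual_mul, conjDual_conjDual hf h0, mul_comm]⟩

theorem aeval_reflect_mul_pow {R A : Type*} [CommRing R] [Ring A] [Algebra R A] {x y : A}
    (h : y * x = 1) (f : R[X]) (N : ℕ) (hN : f.natDegree ≤ N) :
    aeval y (reflect N f) * x ^ N = aeval x f := by
  refine induction_with_natDegree_le
    (fun f => aeval y (reflect N f) * x ^ N = aeval x f) N ?_ ?_ ?_ f hN
  · simp
  · intro n r _ hnN
    obtain ⟨m, rfl⟩ := Nat.exists_eq_add_of_le' hnN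
    have hinv : y ^ m * x ^ m = 1 := by
      clear hN hnN
      induction m with
      | zero => simp
      | succ m ih => rw [pow_succ, pow_succ', mul_assoc, ← mul_assoc y, h, one_mul, ih]
    rw [reflect_C_mul_X_pow, revAt_le hnN, Nat.add_sub_cancel]
    simp only [map_mul, aeval_C, map_pow, aeval_X]
    rw [mul_assoc, pow_add, ← mul_assoc (y ^ m), hinv, one_mul]
  · intro f g _ _ hf hg
    rw [reflect_add, map_add, add_mul, hf, hg, map_add]

theorem aeval_reverse_mul_pow {R A : Type*} [CommRing R] [Ring A] [Algebra R A] {x y : A}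
    (h : y * x = 1) (f : R[X]) :
    aeval y (reverse f) * x ^ f.natDegree = aeval x f :=
  aeval_reflect_mul_pow h f _ le_rfl

theorem star_aeval {A : Type*} [Ring A] [StarRing A] [Algebra F A] [StarModule F A] (x : A)
    (f : F[X]) : star (aeval x f) = aeval (star x) (f.map (starRingEnd F)) := by
  induction f using Polynomial.induction_on' with
  | add f g hf hg => rw [map_add, star_add, hf, hg, Polynomial.map_add, map_add]
  | monomial n a =>
    rw [Polynomial.map_monomial, aeval_monomial, aeval_monomial, star_mul, star_pow,
      ← algebraMap_star_comm, starRingEnd_apply, Algebra.commutes]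

theorem aeval_conjDual {A : Type*} [Ring A] [StarRing A] [Algebra F A] [StarModule F A] {x y : A}
    (h : y * star x = 1) (f : F[X]) :
    aeval y (conjDual f) * star x ^ f.natDegree = (star (f.coeff 0))⁻¹ • star (aeval x f) := by
  rw [conjDual, map_mul, aeval_C, mul_assoc, star_aeval,
    ← aeval_reverse_mul_pow h (f.map (starRingEnd F)), natDegree_map, Algebra.smul_def]

end ConjDual

open Matrix in
theorem Matrix.card_ker_mulVec_star {F : Type*} [Field F] [Finite F] [StarRing F]
    {ι : Type*} [Fintype ι] [DecidableEq ι] (A : Matrix ι ι F) :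
    Nat.card {v // star A *ᵥ v = 0} = Nat.card {v // A *ᵥ v = 0} := by
  have hrank : ∀ B : Matrix ι ι F, Nat.card {v // B *ᵥ v = 0} =
      Nat.card F ^ (Fintype.card ι - B.rank) := by
    intro B
    have h1 := LinearMap.finrank_range_add_finrank_ker B.mulVecLin
    rw [Module.finrank_fintype_fun_eq_card] at h1
    have h2 : Nat.card {v // B *ᵥ v = 0} = Nat.card (LinearMap.ker B.mulVecLin) := rfl
    rw [h2, Module.natCard_eq_pow_finrank (K := F), ← h1, Matrix.rank, Nat.add_sub_cancel_left]
  rw [hrank A, ← Matrix.rank_transpose, ← hrank]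
  refine Nat.card_congr ((Equiv.subtypeEquiv ((Equiv.refl ι).arrowCongr
    (star_involutive (R := F)).toPerm) fun v => ?_).symm)
  have : star A *ᵥ star v = star (Aᵀ *ᵥ v) := by
    ext i
    simp [Matrix.mulVec, dotProduct]
  rw [← star_eq_zero (x := Aᵀ *ᵥ v), ← this]
  rfl

open Matrix in
theorem Matrix.card_torsion_AEval {F : Type*} [Field F] {ι : Type*} [Fintype ι] [DecidableEq ι]
    (A : Matrix ι ι F) (f : F[X]) :
    Nat.card {x : Module.AEval' (Matrix.toLin' A) // f • x = 0} =
      Nat.card {v // aeval A f *ᵥ v = 0} := by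
  refine (Nat.card_congr ((Module.AEval'.of (Matrix.toLin' A)).toEquiv.subtypeEquiv
    fun v => ?_)).symm
  have h : aeval (Matrix.toLin' A) f = Matrix.toLin' (aeval A f) :=
    aeval_algHom_apply (Matrix.toLinAlgEquiv' (R := F) (n := ι)) A f
  have h2 : f • Module.AEval'.of (Matrix.toLin' A) v =
      Module.AEval'.of (Matrix.toLin' A) (aeval A f *ᵥ v) := by
    rw [← Matrix.toLin'_apply, ← h]
    exact (Module.AEval.of_aeval_smul (Matrix.toLin' A) f v).symm
  change _ ↔ f • Module.AEval'.of (Matrix.toLin' A) v = 0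
  rw [h2, LinearEquiv.map_eq_zero_iff]

open Matrix in
theorem Matrix.card_torsion_conjDual {F : Type*} [Field F] [Finite F] [StarRing F]
    {ι : Type*} [Fintype ι] [DecidableEq ι]
    (U : unitaryGroup ι F) {f : F[X]} (h0 : f.coeff 0 ≠ 0) :
    Nat.card {x : Module.AEval' (Matrix.toLin' (U : Matrix ι ι F)) // conjDual f • x = 0} =
      Nat.card {x : Module.AEval' (Matrix.toLin' (U : Matrix ι ι F)) // f • x = 0} := by
  have hU : (U : Matrix ι ι F) * star (U : Matrix ι ι F) = 1 := Unitary.mul_star_self_of_mem U.2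
  have hU' : star (U : Matrix ι ι F) * (U : Matrix ι ι F) = 1 := Unitary.star_mul_self_of_mem U.2
  rw [card_torsion_AEval, card_torsion_AEval,
    ← card_ker_mulVec_star (aeval (U : Matrix ι ι F) f)]
  have key := aeval_conjDual hU f
  have hc : (star (f.coeff 0))⁻¹ ≠ 0 := inv_ne_zero (star_ne_zero.2 h0)
  let P : (Matrix ι ι F)ˣ := ⟨star U, U, hU', hU⟩
  have e : ∀ v, star (aeval (U : Matrix ι ι F) f) *ᵥ v = 0 ↔
      aeval (U : Matrix ι ι F) (conjDual f) *ᵥ ((P ^ f.natDegree : (Matrix ι ι F)ˣ).1 *ᵥ v) = 0 := by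
    intro v
    rw [mulVec_mulVec, Units.val_pow_eq_pow_val, key, smul_mulVec, smul_eq_zero_iff_right hc]
  refine (Nat.card_congr (Equiv.subtypeEquiv
    ⟨fun v => (P ^ f.natDegree : (Matrix ι ι F)ˣ).1 *ᵥ v,
     fun v => (P ^ f.natDegree : (Matrix ι ι F)ˣ)⁻¹.1 *ᵥ v, fun v => ?_, fun v => ?_⟩ e)).symm
  · simp only [mulVec_mulVec]
    rw [Units.inv_mul, one_mulVec]
  · simp only [mulVec_mulVec]
    rw [Units.mul_inv, one_mulVec]

namespace PrimaryDecomposition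

variable {F : Type*} [Field F] [Finite F] {ι : Type*} [Fintype ι] [DecidableEq ι]

theorem coeff_zero_ne_zero {A : Matrix ι ι F} (hA : IsUnit A)
    (D : PrimaryDecomposition F (Module.AEval' (Matrix.toLin' A))) (i : D.ι) :
    (D.p i).coeff 0 ≠ 0 := by
  classical
  intro h0
  have hX : D.p i = X := by
    have := (X_dvd_iff.2 h0)
    exact (eq_of_monic_of_associated monic_X (D.monic i)
      ((irreducible_X.associated_of_dvd (D.irreducible i) this))).symm
  have h1 := D.card_torsion (monic_X (R := F)) irreducible_X 1
  rw [pow_one, Matrix.card_torsion_AEval, aeval_X, natDegree_X, mul_one] at h1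
  have hs : Subsingleton {v // A.mulVec v = 0} := by
    refine ⟨fun v w => Subtype.ext (Matrix.mulVec_injective_of_isUnit hA ?_)⟩
    rw [v.2, w.2]
  have h2 : Nat.card {v // A.mulVec v = 0} = 1 :=
    Nat.card_eq_one_iff_unique.2 ⟨hs, ⟨⟨0, Matrix.mulVec_zero A⟩⟩⟩
  rw [h2] at h1
  have h3 : (∑ i with D.p i = X, min (D.e i) 1) = 0 := by
    by_contra hne
    exact (Nat.one_lt_pow hne Finite.one_lt_card).ne h1
  have := Finset.sum_eq_zero_iff.1 h3 i (by simp [hX])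
  have := D.pos i
  omega

theorem isSelfDual_layer [StarRing F] (U : Matrix.unitaryGroup ι F)
    (D : PrimaryDecomposition F (Module.AEval' (Matrix.toLin' (U : Matrix ι ι F))))
    {j : ℕ} (hj : 0 < j) : IsSelfDual (D.layer j) := by
  classical
  have hunit : IsUnit (U : Matrix ι ι F) :=
    ⟨⟨U, star U, Unitary.mul_star_self_of_mem U.2, Unitary.star_mul_self_of_mem U.2⟩, rfl⟩
  have hc := D.coeff_zero_ne_zero hunit
  refine ⟨monic_prod_of_monic _ _ fun i _ => D.monic i, ?_⟩
  have hmult : ∀ {p : F[X]}, p.Monic → Irreducible p → p.coeff 0 ≠ 0 →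
      D.mult (conjDual p) j = D.mult p j := by
    intro p hp hirr h0
    refine D.mult_eq_of_card_torsion_eq (monic_conjDual h0) (irreducible_conjDual hp h0 hirr)
      hp hirr (natDegree_conjDual h0) (fun k => ?_) j hj
    rw [← conjDual_pow, Matrix.card_torsion_conjDual]
    rw [coeff_zero_eq_eval_zero, eval_pow, ← coeff_zero_eq_eval_zero]
    exact pow_ne_zero _ h0
  have hms : (Finset.univ.filter fun i => D.e i = j).val.map (fun i => conjDual (D.p i)) =
      (Finset.univ.filter fun i => D.e i = j).val.map D.p := by
    rw [← D.normalizedFactors_layer j]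
    ext p
    rw [← D.mult_eq_count, Multiset.count_map, ← Finset.filter_val]
    by_cases hp : ∃ i, D.e i = j ∧ (p = D.p i ∨ p = conjDual (D.p i))
    · obtain ⟨i, hi, hpi⟩ := hp
      have hp : p.Monic ∧ Irreducible p ∧ p.coeff 0 ≠ 0 := by
        rcases hpi with rfl | rfl
        · exact ⟨D.monic i, D.irreducible i, hc i⟩
        · refine ⟨monic_conjDual (hc i), irreducible_conjDual (D.monic i) (hc i) (D.irreducible i),
            ?_⟩
          rw [coeff_zero_conjDual (D.monic i)]
          exact inv_ne_zero (star_ne_zero.2 (hc i))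
      rw [← hmult hp.1 hp.2.1 hp.2.2, mult, Finset.card_val, Finset.filter_filter]
      congr 1
      ext i
      simp only [Finset.mem_filter, Finset.mem_univ, true_and]
      constructor
      · rintro ⟨h1, rfl⟩
        exact ⟨(conjDual_conjDual (D.monic i) (hc i)).symm, h1⟩
      · rintro ⟨h1, h2⟩
        exact ⟨h2, by rw [h1, conjDual_conjDual hp.1 hp.2.2]⟩
    · push Not at hp
      rw [mult, Finset.card_val, Finset.filter_filter, Finset.filter_false_of_mem,
        Finset.filter_false_of_mem]
      · exact fun i _ h => (hp i h.2).1 h.1.symm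
      · exact fun i _ h => (hp i h.1).2 h.2
  rw [layer, conjDual_prod, Finset.prod, hms]
  rfl

theorem sum_natDegree_eq {A : Matrix ι ι F}
    (D : PrimaryDecomposition F (Module.AEval' (Matrix.toLin' A))) :
    ∑ i, D.e i * (D.p i).natDegree = Fintype.card ι := by
  have h := D.card_eq
  rw [← Nat.card_congr (Module.AEval'.of (Matrix.toLin' A)).toEquiv, Nat.card_fun,
    Nat.card_eq_fintype_card (α := ι)] at h
  exact (Nat.pow_right_injective Finite.one_lt_card h).symm

theorem exponent_le {A : Matrix ι ι F}
    (D : PrimaryDecomposition F (Module.AEval' (Matrix.toLin' A))) (i : D.ι) :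
    D.e i ≤ Fintype.card ι := by
  rw [← D.sum_natDegree_eq]
  refine le_trans ?_ (Finset.single_le_sum (f := fun i => D.e i * (D.p i).natDegree)
    (fun _ _ => Nat.zero_le _) (Finset.mem_univ i))
  exact Nat.le_mul_of_pos_right _ (D.irreducible i).natDegree_pos

theorem layer_eq_one {A : Matrix ι ι F}
    (D : PrimaryDecomposition F (Module.AEval' (Matrix.toLin' A))) {j : ℕ}
    (hj : Fintype.card ι < j) : D.layer j = 1 := by
  rw [layer, Finset.filter_false_of_mem fun i _ h => ?_, Finset.prod_empty]
  exact ((D.exponent_le i).trans_lt hj).ne h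

theorem sum_natDegree_layer {A : Matrix ι ι F}
    (D : PrimaryDecomposition F (Module.AEval' (Matrix.toLin' A))) :
    ∑ j ∈ Finset.Icc 1 (Fintype.card ι), j * (D.layer j).natDegree = Fintype.card ι := by
  classical
  conv_rhs => rw [← D.sum_natDegree_eq]
  rw [← Finset.sum_fiberwise_of_maps_to (g := D.e) (t := Finset.Icc 1 (Fintype.card ι))
    fun i _ => Finset.mem_Icc.2 ⟨D.pos i, D.exponent_le i⟩]
  refine Finset.sum_congr rfl fun j _ => ?_
  rw [layer, natDegree_prod _ _ fun i _ => (D.monic i).ne_zero, Finset.mul_sum]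
  refine Finset.sum_congr rfl fun i hi => ?_
  rw [(Finset.mem_filter.1 hi).2]

end PrimaryDecomposition

theorem Matrix.exists_isUnit_mul_eq_of_linearEquiv {F : Type*} [Field F] {ι : Type*} [Fintype ι]
    [DecidableEq ι] {A B : Matrix ι ι F}
    (φ : Module.AEval' (Matrix.toLin' A) ≃ₗ[F[X]] Module.AEval' (Matrix.toLin' B)) :
    ∃ P : Matrix ι ι F, IsUnit P ∧ P * A = B * P := by
  let ψ : (ι → F) ≃ₗ[F] (ι → F) := Module.AEval'.of (Matrix.toLin' A) ≪≫ₗ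
    φ.restrictScalars F ≪≫ₗ (Module.AEval'.of (Matrix.toLin' B)).symm
  have hψ : ∀ v, ψ (A.mulVec v) = B.mulVec (ψ v) := by
    intro v
    have h1 := Module.AEval'.X_smul_of (Matrix.toLin' A) v
    rw [Matrix.toLin'_apply] at h1
    change (Module.AEval'.of (Matrix.toLin' B)).symm (φ (Module.AEval'.of _ (A.mulVec v))) = _
    rw [← h1, map_smul, LinearEquiv.symm_apply_eq, ← Matrix.toLin'_apply,
      ← Module.AEval'.X_smul_of]
    exact congrArg _ ((Module.AEval'.of (Matrix.toLin' B)).apply_symm_apply _).symm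
  refine ⟨LinearMap.toMatrix' ψ.toLinearMap, ?_, ?_⟩
  · refine IsUnit.of_mul_eq_one (LinearMap.toMatrix' ψ.symm.toLinearMap) ?_
    rw [← LinearMap.toMatrix'_comp]
    simp
  · refine Matrix.toLin'.injective (LinearMap.ext fun v => ?_)
    rw [Matrix.toLin'_mul, Matrix.toLin'_mul, Matrix.toLin'_toMatrix']
    exact hψ v

theorem exists_star_ne {F : Type*} [Field F] [Fintype F] [StarRing F] {q : ℕ} (hq : 1 < q)
    (hF : Fintype.card F = q ^ 2) (hstar : ∀ x : F, star x = x ^ q) : ∃ d : F, star d ≠ d := by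
  by_contra! h
  have hne : (X ^ q - X : F[X]) ≠ 0 := FiniteField.X_pow_card_sub_X_ne_zero F hq
  have h1 : Fintype.card F ≤ (X ^ q - X : F[X]).natDegree := by
    rw [← Finset.card_univ]
    refine card_le_degree_of_subset_roots fun x _ => ?_
    rw [mem_roots hne, IsRoot, eval_sub, eval_pow, eval_X, ← hstar, h, sub_self]
  rw [FiniteField.X_pow_card_sub_X_natDegree_eq F hq, hF] at h1
  nlinarith

theorem card_mul_star_eq_one {F : Type*} [Field F] [Fintype F] [StarRing F] {q : ℕ}
    (hF : Fintype.card F = q ^ 2) (hstar : ∀ x : F, star x = x ^ q) :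
    Nat.card {a : F // a * star a = 1} = q + 1 := by
  have h := IsCyclic.card_powMonoidHom_ker (G := Fˣ) (q + 1)
  have h2 : Nat.card Fˣ = (q + 1) * (q - 1) := by
    rw [Nat.card_units, Nat.card_eq_fintype_card, hF, ← Nat.sq_sub_sq, one_pow]
  rw [h2, Nat.gcd_eq_right (Dvd.intro _ rfl)] at h
  rw [← h]
  have hmem : ∀ u : Fˣ, u ∈ (powMonoidHom (q + 1) : Fˣ →* Fˣ).ker ↔ (u : F) * star (u : F) = 1 := by
    intro u
    rw [MonoidHom.mem_ker, powMonoidHom_apply, hstar, ← pow_succ', ← Units.val_pow_eq_pow_val,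
      Units.val_eq_one]
  exact Nat.card_congr ⟨fun a => ⟨Units.mkOfMulEqOne _ _ a.2, (hmem _).2 a.2⟩,
    fun u => ⟨u.1, (hmem _).1 u.2⟩, fun a => rfl, fun u => Subtype.ext (Units.ext rfl)⟩

/-- A semilinear involution fixes the square root of the number of vectors. -/
theorem card_fixed_sq {F : Type*} [Field F] [StarRing F] (d : F) (hd : star d ≠ d)
    {V : Type*} [AddCommGroup V] [Module F V] (τ : V →+ V) (hτ : ∀ v, τ (τ v) = v)
    (hs : ∀ (a : F) v, τ (a • v) = star a • τ v) :
    Nat.card {v // τ v = v} ^ 2 = Nat.card V := by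
  have hd' : d - star d ≠ 0 := sub_ne_zero.2 hd.symm
  have key : ∀ v, τ ((d - star d)⁻¹ • (v - τ v)) = (d - star d)⁻¹ • (v - τ v) := by
    intro v
    rw [hs, map_sub, hτ, star_inv₀, star_sub, star_star, ← neg_sub d, inv_neg, neg_smul,
      ← smul_neg, neg_sub]
  rw [sq, ← Nat.card_prod]
  refine Nat.card_congr (Equiv.ofBijective (fun x => x.1.1 + d • x.2.1)
    ⟨fun x y hxy => ?_, fun v => ?_⟩)
  · have h1 : x.1.1 + d • x.2.1 = y.1.1 + d • y.2.1 := hxy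
    have h2 := congrArg τ h1
    rw [map_add, map_add, hs, hs, x.1.2, y.1.2, x.2.2, y.2.2] at h2
    have h3 : (d - star d) • (x.2.1 - y.2.1) = 0 := by
      rw [sub_smul, smul_sub, smul_sub, sub_eq_zero]
      rw [← sub_eq_zero] at h1 h2 ⊢
      rw [← sub_eq_zero.2 (h1.trans h2.symm)]
      abel
    have h4 : x.2.1 = y.2.1 := sub_eq_zero.1 ((smul_eq_zero_iff_right hd').1 h3)
    rw [h4] at h1
    exact Prod.ext (Subtype.ext (add_right_cancel h1)) (Subtype.ext h4)
  · let w := (d - star d)⁻¹ • (v - τ v)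
    have hw : (d - star d) • w = v - τ v := smul_inv_smul₀ hd' _
    refine ⟨⟨⟨v - d • w, ?_⟩, ⟨w, key v⟩⟩, sub_add_cancel _ _⟩
    rw [map_sub, hs, key v]
    change τ v - star d • w = v - d • w
    rw [sub_smul] at hw
    rw [← sub_eq_zero]
    rw [← sub_eq_zero] at hw
    rw [← hw]
    abel

theorem isSelfDual_iff_coeff {F : Type*} [Field F] [StarRing F] {f : F[X]} (hf : f.Monic) {l : ℕ}
    (hdeg : f.natDegree = l + 1) :
    IsSelfDual f ↔ f.coeff 0 * star (f.coeff 0) = 1 ∧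
      ∀ i : Fin l, f.coeff 0 * star (f.coeff (i.rev + 1)) = f.coeff (i + 1) := by
  have hlead : f.coeff (l + 1) = 1 := hdeg ▸ hf.coeff_natDegree
  have hrev : ∀ i : Fin l, revAt (l + 1) (i + 1) = i.rev + 1 := by
    intro i
    rw [revAt_le (by omega), Fin.val_rev]
    omega
  constructor
  · intro h
    have h0 := congrArg (fun g => coeff g 0) h.2
    simp only [coeff_zero_conjDual hf] at h0
    have h1 : f.coeff 0 * star (f.coeff 0) = 1 := by
      nth_rewrite 1 [← h0]
      exact inv_mul_cancel₀ (star_ne_zero.2 h.coeff_zero_ne_zero)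
    refine ⟨h1, fun i => ?_⟩
    have h2 := congrArg (fun g => coeff g (i + 1)) h.2
    simp only [coeff_conjDual, h0, hdeg, hrev] at h2
    exact h2
  · rintro ⟨h1, h2⟩
    have h0 : (star (f.coeff 0))⁻¹ = f.coeff 0 := (eq_inv_of_mul_eq_one_left h1).symm
    refine ⟨hf, Polynomial.ext fun k => ?_⟩
    rw [coeff_conjDual, hdeg, h0]
    rcases Nat.lt_or_ge (l + 1) k with hk | hk
    · rw [revAt_eq_self_of_lt hk, coeff_eq_zero_of_natDegree_lt (n := k) (by omega), star_zero, mul_zero]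
    · rcases k with _ | k
      · rw [revAt_le hk, Nat.sub_zero, hlead, star_one, mul_one]
      · rcases Nat.lt_or_ge k l with hk' | hk'
        · rw [hrev ⟨k, hk'⟩]
          exact h2 ⟨k, hk'⟩
        · obtain rfl : k = l := by omega
          rw [revAt_le hk, Nat.sub_self, h1, hlead]

theorem card_isSelfDual_succ {F : Type*} [Field F] [Fintype F] [StarRing F] {q : ℕ} (hq : 1 < q)
    (hF : Fintype.card F = q ^ 2) (hstar : ∀ x : F, star x = x ^ q) (l : ℕ) :
    Nat.card {f : F[X] // IsSelfDual f ∧ f.natDegree = l + 1} = (q + 1) * q ^ l := by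
  obtain ⟨d, hd⟩ := exists_star_ne hq hF hstar
  let e : {f : F[X] // f.Monic ∧ f.natDegree = l + 1} ≃ (F × (Fin l → F)) :=
    ((monicEquivDegreeLT (l + 1)).trans (degreeLTEquiv F (l + 1)).toEquiv).trans
      (Fin.consEquiv fun _ => F).symm
  have he : ∀ (f : {f : F[X] // f.Monic ∧ f.natDegree = l + 1}),
      e f = (f.1.coeff 0, fun i : Fin l => f.1.coeff (i + 1)) := by
    intro f
    have hc : ∀ i : Fin (l + 1), f.1.eraseLead.coeff i = f.1.coeff i := fun i =>
      eraseLead_coeff_of_ne _ (by rw [f.2.2]; exact i.2.ne)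
    refine Prod.ext (hc 0) (funext fun i => ?_)
    exact hc i.succ
  have h1 : Nat.card {f : F[X] // IsSelfDual f ∧ f.natDegree = l + 1} =
      Nat.card {x : F × (Fin l → F) // x.1 * star x.1 = 1 ∧
        ∀ i : Fin l, x.1 * star (x.2 i.rev) = x.2 i} := by
    refine Nat.card_congr (Equiv.trans ?_ (e.subtypeEquiv (p := fun f => IsSelfDual f.1) ?_))
    · exact ⟨fun f => ⟨⟨f.1, f.2.1.1, f.2.2⟩, f.2.1⟩, fun f => ⟨f.1.1, f.2, f.1.2.2⟩,
        fun _ => rfl, fun _ => rfl⟩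
    · intro f
      rw [he, isSelfDual_iff_coeff f.2.1 f.2.2]
  let e2 : {x : F × (Fin l → F) // x.1 * star x.1 = 1 ∧
        ∀ i : Fin l, x.1 * star (x.2 i.rev) = x.2 i} ≃
      Σ a : {a : F // a * star a = 1}, {v : Fin l → F // ∀ i, a.1 * star (v i.rev) = v i} :=
    ⟨fun x => ⟨⟨x.1.1, x.2.1⟩, ⟨x.1.2, x.2.2⟩⟩, fun x => ⟨(x.1.1, x.2.1), x.1.2, x.2.2⟩,
      fun _ => rfl, fun _ => rfl⟩
  have h2 : ∀ a : {a : F // a * star a = 1},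
      Nat.card {v : Fin l → F // ∀ i, a.1 * star (v i.rev) = v i} = q ^ l := by
    intro a
    let τ : (Fin l → F) →+ (Fin l → F) :=
      { toFun := fun v i => a.1 * star (v i.rev)
        map_zero' := by ext; simp
        map_add' := fun v w => by ext; simp [mul_add] }
    have := card_fixed_sq d hd τ (fun v => by
      funext i
      change a.1 * star (a.1 * star (v i.rev.rev)) = v i
      rw [star_mul', star_star, ← mul_assoc, a.2, one_mul, Fin.rev_rev]) (fun b v => by
      funext i
      change a.1 * star (b * v i.rev) = star b * (a.1 * star (v i.rev))
      rw [star_mul']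
      ring)
    rw [Nat.card_fun, Nat.card_eq_fintype_card (α := F), hF, Nat.card_fin, ← pow_mul, mul_comm,
      pow_mul] at this
    rw [← Nat.pow_left_injective two_ne_zero this]
    exact Nat.card_congr (Equiv.subtypeEquivRight fun v => funext_iff.symm)
  have : Fintype {a : F // a * star a = 1} := Fintype.ofFinite _
  rw [h1, Nat.card_congr e2, Nat.card_sigma, Finset.sum_congr rfl fun a _ => h2 a,
    Finset.sum_const, Finset.card_univ, ← Nat.card_eq_fintype_card,
    card_mul_star_eq_one hF hstar, smul_eq_mul]

theorem Matrix.exists_layers {F : Type*} [Field F] [Finite F] [StarRing F] {d : F}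
    (hd : star d ≠ d) {ι : Type*} [Fintype ι] [DecidableEq ι] :
    ∃ Φ : ConjClasses (unitaryGroup ι F) → ℕ → F[X],
      (∀ c j, 0 < j → IsSelfDual (Φ c j)) ∧
      (∀ c, ∑ j ∈ Finset.Icc 1 (Fintype.card ι), j * (Φ c j).natDegree = Fintype.card ι) ∧
      ∀ c c', (∀ j ∈ Finset.Icc 1 (Fintype.card ι), Φ c j = Φ c' j) → c = c' := by
  have hD : ∀ U : unitaryGroup ι F,
      Nonempty (PrimaryDecomposition F (Module.AEval' (toLin' (U : Matrix ι ι F)))) := by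
    intro U
    have : Module.Finite F[X] (Module.AEval' (toLin' (U : Matrix ι ι F))) := inferInstance
    exact PrimaryDecomposition.exists_of_isTorsion
      (Module.AEval.isTorsion_of_finiteDimensional F (ι → F) _)
  let D := fun U => (hD U).some
  refine ⟨fun c j => (D (Quotient.out c)).layer j, fun c j hj =>
    PrimaryDecomposition.isSelfDual_layer _ _ hj, fun c =>
    PrimaryDecomposition.sum_natDegree_layer _, fun c c' h => ?_⟩
  obtain ⟨φ⟩ := (D (Quotient.out c)).nonempty_linearEquiv_of_layer_eq (D (Quotient.out c'))
    (fun j hj => by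
      rcases Nat.lt_or_ge (Fintype.card ι) j with hj' | hj'
      · rw [PrimaryDecomposition.layer_eq_one _ hj', PrimaryDecomposition.layer_eq_one _ hj']
      · exact h j (Finset.mem_Icc.2 ⟨hj, hj'⟩))
  obtain ⟨P, hP, hPU⟩ := exists_isUnit_mul_eq_of_linearEquiv φ
  have := unitaryGroup_isConj_of_isUnit d hd (Quotient.out c) (Quotient.out c') P hP hPU
  rw [← ConjClasses.mk_eq_mk_iff_isConj] at this
  exact (Quotient.out_eq c).symm.trans (this.trans (Quotient.out_eq c'))

theorem isSelfDual_natDegree_zero_iff {F : Type*} [Field F] [StarRing F] {f : F[X]} :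
    IsSelfDual f ∧ f.natDegree = 0 ↔ f = 1 := by
  constructor
  · exact fun h => h.1.1.natDegree_eq_zero.1 h.2
  · rintro rfl
    exact ⟨⟨monic_one, conjDual_one⟩, natDegree_one⟩

theorem card_isSelfDual_zero {F : Type*} [Field F] [StarRing F] :
    Nat.card {f : F[X] // IsSelfDual f ∧ f.natDegree = 0} = 1 := by
  simp_rw [isSelfDual_natDegree_zero_iff]
  exact Nat.card_unique

section Counting

variable {F : Type*} [Field F] [Fintype F] [StarRing F] {q : ℕ}

theorem finite_isSelfDual_natDegree_le (hq : 1 < q) (hF : Fintype.card F = q ^ 2)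
    (hstar : ∀ x : F, star x = x ^ q) (n : ℕ) :
    {f : F[X] | IsSelfDual f ∧ f.natDegree ≤ n}.Finite := by
  have h : ∀ m, {f : F[X] | IsSelfDual f ∧ f.natDegree = m}.Finite := by
    intro m
    refine Nat.finite_of_card_ne_zero (α := {f : F[X] // IsSelfDual f ∧ f.natDegree = m}) ?_
    rcases m with _ | m
    · rw [card_isSelfDual_zero]
      exact one_ne_zero
    · rw [card_isSelfDual_succ hq hF hstar]
      positivity
  refine ((Set.finite_Iic n).biUnion fun m _ => h m).subset fun f hf => ?_
  exact Set.mem_biUnion (Set.mem_Iic.2 hf.2) ⟨hf.1, rfl⟩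

theorem card_isSelfDual_le (hq : 1 < q) (hF : Fintype.card F = q ^ 2)
    (hstar : ∀ x : F, star x = x ^ q) (m : ℕ) :
    (Nat.card {f : F[X] // IsSelfDual f ∧ f.natDegree = m} : ℝ) ≤ (1 + 1 / q) * q ^ m := by
  have hq0 : (0 : ℝ) < q := by exact_mod_cast (by omega : 0 < q)
  rcases m with _ | m
  · rw [card_isSelfDual_zero]
    simp
  · rw [card_isSelfDual_succ hq hF hstar]
    push_cast
    refine le_of_eq ?_
    field_simp
    ring

theorem sum_card_isSelfDual_le (hq : 1 < q) (hF : Fintype.card F = q ^ 2)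
    (hstar : ∀ x : F, star x = x ^ q) (n i : ℕ) :
    ∑ m ∈ Finset.range (n + 1), (Nat.card {f : F[X] // IsSelfDual f ∧ f.natDegree = m} : ℝ) *
      ((q : ℝ) ^ ((i + 2) * m))⁻¹ ≤ 1 + (q + 1) / (q ^ (i + 2) - q) := by
  have hq0 : (1 : ℝ) < q := by exact_mod_cast hq
  have hlt : (1 : ℝ) < q ^ (i + 1) := one_lt_pow₀ hq0 (by omega)
  have hgeom : ∑ l ∈ Finset.range n, (((q : ℝ) ^ (i + 1))⁻¹) ^ l ≤
      (1 - ((q : ℝ) ^ (i + 1))⁻¹)⁻¹ := by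
    have h0 : (0 : ℝ) ≤ ((q : ℝ) ^ (i + 1))⁻¹ := by positivity
    have h1 : ((q : ℝ) ^ (i + 1))⁻¹ < 1 := inv_lt_one_of_one_lt₀ hlt
    rw [← tsum_geometric_of_lt_one h0 h1]
    exact (summable_geometric_of_lt_one h0 h1).sum_le_tsum _ fun l _ => pow_nonneg h0 l
  rw [Finset.sum_range_succ', card_isSelfDual_zero]
  have hterm : ∀ l, (Nat.card {f : F[X] // IsSelfDual f ∧ f.natDegree = l + 1} : ℝ) *
      ((q : ℝ) ^ ((i + 2) * (l + 1)))⁻¹ =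
      ((q + 1) / q ^ (i + 2)) * (((q : ℝ) ^ (i + 1))⁻¹) ^ l := by
    intro l
    rw [card_isSelfDual_succ hq hF hstar]
    push_cast
    rw [inv_pow, ← pow_mul]
    field_simp
    ring
  rw [Finset.sum_congr rfl fun l _ => hterm l, ← Finset.mul_sum, add_comm]
  have : (q + 1 : ℝ) / (q ^ (i + 2) - q) =
      ((q + 1) / q ^ (i + 2)) * (1 - ((q : ℝ) ^ (i + 1))⁻¹)⁻¹ := by
    have h1 : (q : ℝ) ^ (i + 1) - 1 ≠ 0 := (sub_pos.2 hlt).ne'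
    have h2 : (q : ℝ) ^ (i + 2) - q = q * (q ^ (i + 1) - 1) := by ring
    rw [h2]
    field_simp
    ring
  rw [this]
  refine add_le_add (by simp) (mul_le_mul_of_nonneg_left hgeom (by positivity))

theorem card_conjClasses_le (hq : 1 < q) (hF : Fintype.card F = q ^ 2)
    (hstar : ∀ x : F, star x = x ^ q) (k : ℕ) :
    (Nat.card (ConjClasses (Matrix.unitaryGroup (Fin (k + 1)) F)) : ℝ) ≤
      q ^ (k + 1) * ((1 + 1 / q) *
        ∏ i ∈ Finset.range k, (1 + ((q : ℝ) + 1) / (q ^ (i + 2) - q))) := by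
  classical
  have hq0 : (0 : ℝ) < q := by exact_mod_cast (by omega : 0 < q)
  obtain ⟨d, hd⟩ := exists_star_ne hq hF hstar
  obtain ⟨Φ, hΦ, hsum, hinj⟩ := Matrix.exists_layers hd (ι := Fin (k + 1))
  rw [Fintype.card_fin] at hsum hinj
  let S := (finite_isSelfDual_natDegree_le hq hF hstar (k + 1)).toFinset
  have hcount : ∀ m ≤ k + 1, (S.filter fun f => f.natDegree = m).card =
      Nat.card {f : F[X] // IsSelfDual f ∧ f.natDegree = m} := by
    intro m hm
    refine (Nat.subtype_card _ fun f => ?_).symm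
    simp only [S, Finset.mem_filter, Set.Finite.mem_toFinset, Set.mem_ofPred_eq]
    constructor
    · exact fun h => ⟨h.1.1, h.2⟩
    · exact fun h => ⟨⟨h.1, h.2.le.trans hm⟩, h.2⟩
  let w : (Fin k → F[X]) → ℕ := fun g => ∑ i, (i.1 + 2) * (g i).natDegree
  let Ω := (Fintype.piFinset fun _ : Fin k => S).sigma
    fun g => S.filter fun h => h.natDegree + w g = k + 1
  have hsum' : ∀ c, (Φ c 1).natDegree + w (fun i => Φ c (i + 2)) = k + 1 := by
    intro c
    have h := hsum c
    rw [← Finset.Ico_add_one_right_eq_Icc, Finset.sum_Ico_eq_sum_range, Nat.add_sub_cancel,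
      Finset.sum_range_succ', Finset.sum_range, add_comm] at h
    rw [← h]
    simp only [w, add_zero, one_mul]
    refine congrArg _ (Finset.sum_congr rfl fun i _ => ?_)
    rw [show (1 + (i.1 + 1)) = i.1 + 2 by ring]
  have hle : Nat.card (ConjClasses (Matrix.unitaryGroup (Fin (k + 1)) F)) ≤ Ω.card := by
    rw [← Nat.card_eq_finsetCard]
    refine Nat.card_le_card_of_injective (fun c => ⟨⟨fun i => Φ c (i + 2), Φ c 1⟩, ?_⟩) ?_
    · have hdeg := hsum' c
      simp only [Ω, S, Finset.mem_sigma, Fintype.mem_piFinset, Finset.mem_filter,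
        Set.Finite.mem_toFinset, Set.mem_ofPred_eq]
      refine ⟨fun i => ⟨hΦ c _ (by omega), ?_⟩, ⟨hΦ c 1 one_pos, by omega⟩, hdeg⟩
      have h1 : (i.1 + 2) * (Φ c (i + 2)).natDegree ≤ w fun i => Φ c (i + 2) :=
        Finset.single_le_sum (f := fun i : Fin k => (i.1 + 2) * (Φ c (i + 2)).natDegree)
          (fun _ _ => Nat.zero_le _) (Finset.mem_univ i)
      have h2 : (Φ c (i + 2)).natDegree ≤ (i.1 + 2) * (Φ c (i + 2)).natDegree :=
        Nat.le_mul_of_pos_left _ (by omega)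
      omega
    · intro c c' h
      have h := congrArg Subtype.val h
      simp only [Sigma.mk.injEq, heq_eq_eq] at h
      refine hinj c c' fun j hj => ?_
      rw [Finset.mem_Icc] at hj
      rcases hj.1.eq_or_lt with rfl | hj1
      · exact h.2
      · obtain ⟨j, rfl⟩ := Nat.exists_eq_add_of_le' hj1
        exact congrFun h.1 ⟨j, by omega⟩
  have hfib : ∀ g, ((S.filter fun h => h.natDegree + w g = k + 1).card : ℝ) ≤
      (1 + 1 / q) * q ^ (k + 1) * ∏ i, ((q : ℝ) ^ ((i.1 + 2) * (g i).natDegree))⁻¹ := by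
    intro g
    rw [Finset.prod_inv_distrib, Finset.prod_pow_eq_pow_sum]
    change _ ≤ _ * ((q : ℝ) ^ w g)⁻¹
    rcases Nat.lt_or_ge (k + 1) (w g) with hw | hw
    · rw [Finset.filter_false_of_mem fun h _ hh => by omega, Finset.card_empty, Nat.cast_zero]
      positivity
    · have h1 : (S.filter fun h => h.natDegree + w g = k + 1) =
          S.filter fun h => h.natDegree = k + 1 - w g :=
        Finset.filter_congr fun h _ => by omega
      rw [h1, hcount _ (Nat.sub_le _ _)]
      refine (card_isSelfDual_le hq hF hstar _).trans_eq ?_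
      rw [pow_sub₀ _ hq0.ne' hw, mul_assoc]
  have hS : ∀ i : ℕ, ∑ f ∈ S, ((q : ℝ) ^ ((i + 2) * f.natDegree))⁻¹ ≤
      1 + (q + 1) / (q ^ (i + 2) - q) := by
    intro i
    refine le_trans (le_of_eq ?_) (sum_card_isSelfDual_le hq hF hstar (k + 1) i)
    rw [← Finset.sum_fiberwise_of_maps_to (g := natDegree) (t := Finset.range (k + 2))]
    · refine Finset.sum_congr rfl fun m hm => ?_
      rw [← hcount m (Nat.lt_succ_iff.1 (Finset.mem_range.1 hm)), ← nsmul_eq_mul,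
        ← Finset.sum_const]
      refine Finset.sum_congr rfl fun f hf => ?_
      rw [(Finset.mem_filter.1 hf).2]
    · intro f hf
      simp only [S, Set.Finite.mem_toFinset, Set.mem_ofPred_eq] at hf
      exact Finset.mem_range.2 (Nat.lt_succ_iff.2 hf.2)
  calc (Nat.card (ConjClasses (Matrix.unitaryGroup (Fin (k + 1)) F)) : ℝ) ≤ Ω.card := by
        exact_mod_cast hle
    _ = ∑ g ∈ Fintype.piFinset fun _ : Fin k => S,
        ((S.filter fun h => h.natDegree + w g = k + 1).card : ℝ) := by
      rw [Finset.card_sigma, Nat.cast_sum]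
    _ ≤ ∑ g ∈ Fintype.piFinset fun _ : Fin k => S,
        (1 + 1 / q) * q ^ (k + 1) * ∏ i, ((q : ℝ) ^ ((i.1 + 2) * (g i).natDegree))⁻¹ :=
      Finset.sum_le_sum fun g _ => hfib g
    _ = (1 + 1 / q) * q ^ (k + 1) *
        ∏ i : Fin k, ∑ f ∈ S, ((q : ℝ) ^ ((i.1 + 2) * f.natDegree))⁻¹ := by
      rw [← Finset.mul_sum, Finset.prod_univ_sum]
    _ ≤ (1 + 1 / q) * q ^ (k + 1) * ∏ i : Fin k, (1 + ((q : ℝ) + 1) / (q ^ (i.1 + 2) - q)) := by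
      refine mul_le_mul_of_nonneg_left (Finset.prod_le_prod (fun i _ => ?_) fun i _ => hS i)
        (by positivity)
      exact Finset.sum_nonneg fun f _ => by positivity
    _ = _ := by
      rw [Finset.prod_range fun i => (1 + ((q : ℝ) + 1) / (q ^ (i + 2) - q))]
      ring

end Counting

theorem prod_le_of_three_le {q : ℝ} (hq : 3 ≤ q) (k : ℕ) :
    (1 + 1 / q) * ∏ i ∈ Finset.range k, (1 + (q + 1) / (q ^ (i + 2) - q)) ≤ 1 + 7 / q := by
  have hq0 : 0 < q := by linarith
  have hmain : ∀ m : ℕ, (1 + 1 / q) *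
      ∏ i ∈ Finset.range (m + 1), (1 + (q + 1) / (q ^ (i + 2) - q)) ≤
        1 + 7 / q - 15 / 2 / q ^ (m + 2) := by
    intro m
    induction m with
    | zero =>
      rw [Finset.prod_range_one]
      have h1 : 0 < q - 1 := by linarith
      have h2 : 1 + 7 / q - 15 / 2 / q ^ 2 -
          (1 + 1 / q) * (1 + (q + 1) / (q ^ 2 - q)) =
          (5 * q ^ 2 - 31 / 2 * q + 13 / 2) / (q ^ 2 * (q - 1)) := by
        have h3 : q ^ 2 - q = q * (q - 1) := by ring
        rw [h3]
        field_simp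
        ring
      have h4 : 0 ≤ (5 * q ^ 2 - 31 / 2 * q + 13 / 2) / (q ^ 2 * (q - 1)) :=
        div_nonneg (by nlinarith) (by positivity)
      simp only [zero_add]
      linarith
    | succ m ih =>
      rw [Finset.prod_range_succ, ← mul_assoc]
      set R := (1 + 1 / q) * ∏ i ∈ Finset.range (m + 1), (1 + (q + 1) / (q ^ (i + 2) - q))
      obtain ⟨t, ht⟩ : ∃ t, t = q ^ (m + 2) := ⟨_, rfl⟩
      have ht9 : 9 ≤ t := by
        rw [ht]
        calc (9 : ℝ) = 3 ^ 2 := by norm_num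
          _ ≤ q ^ 2 := by gcongr
          _ ≤ q ^ (m + 2) := pow_le_pow_right₀ (by linarith) (by omega)
      have hs : q ^ (m + 1 + 2) = q * t := by rw [ht]; ring
      rw [hs]
      rw [← ht] at ih
      have ht1 : 0 < t - 1 := by linarith
      have hR : R ≤ 10 / 3 := by
        have h1 : 7 / q ≤ 7 / 3 := by gcongr
        have h2 : 0 ≤ 15 / 2 / t := by positivity
        linarith
      have hfac : 0 ≤ (q + 1) / (q * t - q) :=
        div_nonneg (by linarith) (by nlinarith)
      have h3 : R * ((q + 1) / (q * t - q)) ≤ 10 / 3 * ((q + 1) / (q * t - q)) := by gcongr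
      have h4 : 15 / 2 / t - 15 / 2 / (q * t) - 10 / 3 * ((q + 1) / (q * t - q)) =
          (15 / 2 * (q - 1) * (t - 1) - 10 / 3 * (q + 1) * t) / (q * t * (t - 1)) := by
        have h5 : q * t - q = q * (t - 1) := by ring
        have : 0 < t := by linarith
        rw [h5]
        field_simp
      have h6 : 0 ≤ (15 / 2 * (q - 1) * (t - 1) - 10 / 3 * (q + 1) * t) / (q * t * (t - 1)) := by
        refine div_nonneg ?_ (by positivity)
        nlinarith [mul_nonneg (sub_nonneg.2 hq) (sub_nonneg.2 ht9)]
      linarith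
  rcases k with _ | m
  · rw [Finset.prod_range_zero, mul_one]
    gcongr
    norm_num
  · have := hmain m
    have : 0 ≤ 15 / 2 / q ^ (m + 2) := by positivity
    linarith

theorem prod_le_nine (k : ℕ) :
    (1 + 1 / 2) * ∏ i ∈ Finset.range k, (1 + ((2 : ℝ) + 1) / (2 ^ (i + 2) - 2)) ≤ 9 := by
  have hmain : ∀ m : ℕ, (1 + 1 / 2) *
      ∏ i ∈ Finset.range (m + 3), (1 + ((2 : ℝ) + 1) / (2 ^ (i + 2) - 2)) ≤
        9 - 29 / 2 ^ (m + 4) := by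
    intro m
    induction m with
    | zero =>
      norm_num [Finset.prod_range_succ]
    | succ m ih =>
      rw [show m + 1 + 3 = (m + 3) + 1 by ring, Finset.prod_range_succ, ← mul_assoc]
      set R := (1 + 1 / 2) * ∏ i ∈ Finset.range (m + 3), (1 + ((2 : ℝ) + 1) / (2 ^ (i + 2) - 2))
      obtain ⟨t, ht⟩ : ∃ t : ℝ, t = 2 ^ (m + 4) := ⟨_, rfl⟩
      have ht16 : 16 ≤ t := by
        rw [ht]
        calc (16 : ℝ) = 2 ^ 4 := by norm_num
          _ ≤ 2 ^ (m + 4) := pow_le_pow_right₀ (by norm_num) (by omega)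
      rw [show (2 : ℝ) ^ (m + 3 + 2) = 2 * t by rw [ht]; ring]
      rw [← ht] at ih
      have hR : R ≤ 9 := by
        have h2 : 0 ≤ 29 / t := by positivity
        linarith
      have hfac : 0 ≤ ((2 : ℝ) + 1) / (2 * t - 2) :=
        div_nonneg (by norm_num) (by linarith)
      have h3 : R * ((2 + 1) / (2 * t - 2)) ≤ 9 * ((2 + 1) / (2 * t - 2)) := by gcongr
      have h4 : 29 / t - 29 / (2 * t) - 9 * ((2 + 1) / (2 * t - 2)) =
          (29 * (t - 1) - 27 * t) / (2 * t * (t - 1)) := by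
        have ht1 : t - 1 ≠ 0 := by linarith
        have : t ≠ 0 := by linarith
        rw [show 2 * t - 2 = 2 * (t - 1) by ring]
        field_simp
        ring
      have h6 : 0 ≤ (29 * (t - 1) - 27 * t) / (2 * t * (t - 1)) :=
        div_nonneg (by linarith) (mul_nonneg (by linarith) (by linarith))
      linarith
  rcases Nat.lt_or_ge k 3 with hk | hk
  · interval_cases k <;> norm_num [Finset.prod_range_succ]
  · obtain ⟨m, rfl⟩ := Nat.exists_eq_add_of_le' hk
    have := hmain m
    have : (0 : ℝ) ≤ 29 / 2 ^ (m + 4) := by positivity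
    linarith

/-- The characteristic polynomials of isometries of nondegenerate hermitian forms. -/
def IsIsometryCharpoly {F : Type*} [Field F] [StarRing F] (f : F[X]) : Prop :=
  ∃ (ι : Type) (_ : Fintype ι) (_ : DecidableEq ι) (A H : Matrix ι ι F),
    star H = H ∧ IsUnit H ∧ star A * H * A = H ∧ A.charpoly = f

section

variable {F : Type*} [Field F]

open Matrix in
theorem Matrix.isUnit_of_charpoly_coeff_zero_ne_zero {ι : Type*} [Fintype ι] [DecidableEq ι]
    {A : Matrix ι ι F} (h : A.charpoly.coeff 0 ≠ 0) : IsUnit A := by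
  rw [isUnit_iff_isUnit_det, det_eq_sign_charpoly_coeff]
  exact (mul_ne_zero (pow_ne_zero _ (neg_ne_zero.2 one_ne_zero)) h).isUnit

open Matrix in
theorem Matrix.charpoly_star_inv [StarRing F] {ι : Type*} [Fintype ι] [DecidableEq ι]
    {A : Matrix ι ι F} (h : A.charpoly.coeff 0 ≠ 0) :
    (star A)⁻¹.charpoly = conjDual A.charpoly := by
  have hs : (star A).charpoly = A.charpoly.map (starRingEnd F) := by
    rw [← charpoly_transpose A, ← charpoly_map]
    rfl
  have h0 : (star A).charpoly.coeff 0 = star (A.charpoly.coeff 0) := by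
    rw [hs, coeff_map]
    rfl
  have hu : IsUnit (star A) :=
    isUnit_of_charpoly_coeff_zero_ne_zero (by rw [h0]; exact star_ne_zero.2 h)
  rw [charpoly_inv _ hu, conjDual, ← hs, reverse_charpoly, det_eq_sign_charpoly_coeff, h0,
    Ring.inverse_eq_inv', mul_inv, C_mul, ← mul_assoc]
  congr 1
  rw [← inv_pow, inv_neg_one, map_pow, map_neg, map_one, ← mul_pow, neg_one_mul,
    neg_neg, one_pow, one_mul]

theorem exists_charpoly_eq {p : F[X]} (hp : p.Monic) :
    ∃ (ι : Type) (_ : Fintype ι) (_ : DecidableEq ι) (A : Matrix ι ι F), A.charpoly = p :=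
  ⟨_, inferInstance, inferInstance,
    Algebra.leftMulMatrix (AdjoinRoot.powerBasis hp.ne_zero).basis
      (AdjoinRoot.powerBasis hp.ne_zero).gen, by
      rw [charpoly_leftMulMatrix, AdjoinRoot.minpoly_powerBasis_gen_of_monic hp]⟩

theorem Matrix.ker_toSpanSingleton {ι : Type*} [Fintype ι] [DecidableEq ι] {A : Matrix ι ι F}
    (hA : Irreducible A.charpoly) {v : Module.AEval' (toLin' A)} (hv : v ≠ 0) :
    LinearMap.ker (LinearMap.toSpanSingleton F[X] _ v) = Ideal.span {A.charpoly} := by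
  have hmax : (Ideal.span {A.charpoly}).IsMaximal :=
    PrincipalIdealRing.isMaximal_of_irreducible hA
  refine (hmax.eq_of_le ?_ ?_).symm
  · intro h
    have : (1 : F[X]) ∈ LinearMap.ker (LinearMap.toSpanSingleton F[X] _ v) := by
      rw [h]; trivial
    rw [LinearMap.mem_ker, LinearMap.toSpanSingleton_apply, one_smul] at this
    exact hv this
  · rw [Ideal.span_singleton_le_iff_mem, LinearMap.mem_ker, LinearMap.toSpanSingleton_apply]
    obtain ⟨v, rfl⟩ := (Module.AEval'.of (toLin' A)).surjective v
    have h := Module.AEval.of_aeval_smul (R := F) (toLin' A) A.charpoly v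
    rw [← charpoly_toLin', LinearMap.aeval_self_charpoly] at h
    rw [← charpoly_toLin']
    refine h.symm.trans ?_
    rw [zero_smul]
    exact map_zero _

theorem Matrix.toSpanSingleton_surjective [Finite F] {ι : Type*} [Fintype ι] [DecidableEq ι]
    {A : Matrix ι ι F} (hA : Irreducible A.charpoly) {v : Module.AEval' (toLin' A)} (hv : v ≠ 0) :
    Function.Surjective (LinearMap.toSpanSingleton F[X] _ v) := by
  let f := LinearMap.toSpanSingleton F[X] (Module.AEval' (toLin' A)) v
  have hfin : Finite (Module.AEval' (toLin' A)) :=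
    Finite.of_equiv _ (Module.AEval'.of (toLin' A)).toEquiv
  have h1 : Nat.card (LinearMap.range f) = Nat.card (Module.AEval' (toLin' A)) := by
    rw [← Nat.card_congr f.quotKerEquivRange.toEquiv, ker_toSpanSingleton hA hv]
    have h2 := PrimaryDecomposition.card_quotient_span_pow A.charpoly_monic 1
    rw [pow_one, one_mul, charpoly_natDegree_eq_dim] at h2
    rw [h2, ← Nat.card_congr (Module.AEval'.of (toLin' A)).toEquiv, Nat.card_fun,
      Nat.card_eq_fintype_card (α := ι)]
  have h3 : (LinearMap.range f : Set (Module.AEval' (toLin' A))) = Set.univ :=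
    Set.eq_of_subset_of_ncard_le (Set.subset_univ _) (by
      rw [Set.ncard_univ, ← h1]
      rfl)
  exact LinearMap.range_eq_top.1 (SetLike.coe_injective h3)

theorem Matrix.isUnit_of_commute [Finite F] {ι : Type*} [Fintype ι] [DecidableEq ι]
    {A L : Matrix ι ι F} (hA : Irreducible A.charpoly) (hL : L * A = A * L) (hne : L ≠ 0) :
    IsUnit L := by
  rw [isUnit_iff_isUnit_det, isUnit_iff_ne_zero]
  intro hdet
  obtain ⟨v, hv, hLv⟩ := exists_mulVec_eq_zero_iff.2 hdet
  refine hne (toLin'.injective (LinearMap.ext fun w => ?_))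
  obtain ⟨g, hg⟩ := toSpanSingleton_surjective hA
    (v := Module.AEval'.of (toLin' A) v) (by simpa using hv) (Module.AEval'.of (toLin' A) w)
  rw [LinearMap.toSpanSingleton_apply] at hg
  have h1 : g • Module.AEval'.of (toLin' A) v =
      Module.AEval'.of (toLin' A) (aeval (toLin' A) g v) :=
    (Module.AEval.of_aeval_smul (toLin' A) g v).symm
  rw [h1] at hg
  have h2 := (Module.AEval'.of (toLin' A)).injective hg
  have h3 : aeval (toLin' A) g = toLin' (aeval A g) :=
    aeval_algHom_apply (toLinAlgEquiv' (R := F) (n := ι)) A g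
  have h4 : Commute L (aeval A g) := by
    have h5 : ∀ f : F[X], Commute L (aeval A f) := fun f => by
      induction f using Polynomial.induction_on' with
      | add f g hf hg => rw [map_add]; exact hf.add_right hg
      | monomial n a =>
        rw [aeval_monomial]
        exact (Algebra.commute_algebraMap_right a L).mul_right (Commute.pow_right hL n)
    exact h5 g
  rw [← h2, h3, toLin'_apply, toLin'_apply, mulVec_mulVec, h4.eq, ← mulVec_mulVec, hLv,
    mulVec_zero]
  simp

theorem Matrix.exists_isUnit_mul_eq_of_charpoly_eq [Finite F] {ι : Type*} [Fintype ι]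
    [DecidableEq ι] {A B : Matrix ι ι F} (hA : Irreducible A.charpoly)
    (h : A.charpoly = B.charpoly) : ∃ P : Matrix ι ι F, IsUnit P ∧ P * A = B * P := by
  have hι : Nonempty ι := by
    rw [← Fintype.card_pos_iff, ← charpoly_natDegree_eq_dim A]
    exact hA.natDegree_pos
  have hiso : ∀ {C : Matrix ι ι F}, Irreducible C.charpoly →
      Nonempty ((F[X] ⧸ Ideal.span {C.charpoly}) ≃ₗ[F[X]] Module.AEval' (toLin' C)) := by
    intro C hC
    obtain ⟨v, hv⟩ := exists_ne (0 : ι → F)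
    have hv' : Module.AEval'.of (toLin' C) v ≠ 0 := by simpa using hv
    exact ⟨Submodule.quotEquivOfEq _ _ (ker_toSpanSingleton hC hv').symm ≪≫ₗ
      LinearMap.quotKerEquivOfSurjective _ (toSpanSingleton_surjective hC hv')⟩
  obtain ⟨φ⟩ := hiso hA
  obtain ⟨ψ⟩ := hiso (h ▸ hA)
  exact exists_isUnit_mul_eq_of_linearEquiv
    (φ.symm ≪≫ₗ Submodule.quotEquivOfEq _ _ (by rw [h]) ≪≫ₗ ψ)

variable [StarRing F]

theorem isIsometryCharpoly_one : IsIsometryCharpoly (1 : F[X]) :=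
  ⟨Empty, inferInstance, inferInstance, 1, 1, star_one _, isUnit_one, by simp,
    Matrix.charpoly_isEmpty⟩

open Matrix in
theorem IsIsometryCharpoly.mul {f g : F[X]} (hf : IsIsometryCharpoly f)
    (hg : IsIsometryCharpoly g) : IsIsometryCharpoly (f * g) := by
  obtain ⟨ι, _, _, A, H, hH, hu, hA, rfl⟩ := hf
  obtain ⟨κ, _, _, B, K, hK, hv, hB, rfl⟩ := hg
  rw [star_eq_conjTranspose] at *
  refine ⟨ι ⊕ κ, inferInstance, inferInstance, fromBlocks A 0 0 B, fromBlocks H 0 0 K, ?_, ?_, ?_,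
    charpoly_fromBlocks_zero₁₂ ..⟩
  · rw [star_eq_conjTranspose, fromBlocks_conjTranspose, hH, hK, conjTranspose_zero,
      conjTranspose_zero]
  · exact isUnit_fromBlocks_zero₂₁.2 ⟨hu, hv⟩
  · rw [star_eq_conjTranspose, fromBlocks_conjTranspose, fromBlocks_multiply, fromBlocks_multiply]
    simp [hA, hB]

open Matrix in
theorem isIsometryCharpoly_mul_conjDual {p : F[X]} (hp : p.Monic) (h0 : p.coeff 0 ≠ 0) :
    IsIsometryCharpoly (p * conjDual p) := by
  obtain ⟨ι, _, _, A, rfl⟩ := exists_charpoly_eq hp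
  have hA := (isUnit_iff_isUnit_det _).1 (isUnit_of_charpoly_coeff_zero_ne_zero h0)
  have hA' : IsUnit Aᴴ.det := by rw [det_conjTranspose]; exact hA.star
  refine ⟨ι ⊕ ι, inferInstance, inferInstance, fromBlocks A 0 0 (star A)⁻¹, fromBlocks 0 1 1 0,
    ?_, ?_, ?_, ?_⟩
  · rw [star_eq_conjTranspose, fromBlocks_conjTranspose]
    simp
  · exact IsUnit.of_mul_eq_one (fromBlocks 0 1 1 0) (by simp [fromBlocks_multiply])
  · simp only [star_eq_conjTranspose]
    rw [fromBlocks_conjTranspose, fromBlocks_multiply, fromBlocks_multiply]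
    simp [conjTranspose_nonsing_inv, nonsing_inv_mul _ hA, mul_nonsing_inv _ hA']
  · rw [charpoly_fromBlocks_zero₁₂, charpoly_star_inv h0]

open Matrix in
theorem isIsometryCharpoly_of_irreducible [Finite F] {d : F} (hd : star d ≠ d) {p : F[X]}
    (hp : IsSelfDual p) (hirr : Irreducible p) : IsIsometryCharpoly p := by
  obtain ⟨ι, _, _, A, rfl⟩ := exists_charpoly_eq hp.1
  have h0 := hp.coeff_zero_ne_zero
  have hu := isUnit_of_charpoly_coeff_zero_ne_zero h0
  have hA : IsUnit A.det := (isUnit_iff_isUnit_det _).1 hu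
  have hA' : IsUnit (star A).det := by
    rw [star_eq_conjTranspose, det_conjTranspose]
    exact hA.star
  obtain ⟨P, hP, hPA⟩ := exists_isUnit_mul_eq_of_charpoly_eq (B := (star A)⁻¹) hirr
    (by rw [charpoly_star_inv h0, hp.2])
  have hι : Nonempty ι := by
    rw [← Fintype.card_pos_iff, ← charpoly_natDegree_eq_dim A]
    exact hirr.natDegree_pos
  have h1 : star A * P * A = P := by
    rw [mul_assoc, hPA, ← mul_assoc, mul_nonsing_inv _ hA', one_mul]
  have h2 : star A * star P * A = star P := by
    have := congrArg star h1
    rwa [star_mul, star_mul, star_star, ← mul_assoc] at this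
  obtain ⟨c, hc⟩ : ∃ c : F, c • P + star c • star P ≠ 0 := by
    by_contra! h
    have h3 := h 1
    have h4 := h d
    rw [star_one, one_smul, one_smul] at h3
    rw [eq_neg_of_add_eq_zero_right h3, smul_neg, ← sub_eq_add_neg, ← sub_smul,
      smul_eq_zero_iff_right (sub_ne_zero.2 hd.symm)] at h4
    exact hP.ne_zero h4
  obtain ⟨H, hH⟩ : ∃ H, H = c • P + star c • star P := ⟨_, rfl⟩
  have hHA : star A * H * A = H := by
    rw [hH, mul_add, add_mul, mul_smul_comm, mul_smul_comm, smul_mul_assoc, smul_mul_assoc, h1, h2]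
  refine ⟨ι, inferInstance, inferInstance, A, H, ?_, ?_, hHA, rfl⟩
  · rw [hH, star_add, star_smul, star_smul, star_star, star_star, add_comm]
  · obtain ⟨u, rfl⟩ := hP
    have hcomm : (u⁻¹.1 * H) * A = A * (u⁻¹.1 * H) := by
      have h5 : H * A = (star A)⁻¹ * H := by
        conv_rhs => rw [← hHA]
        rw [mul_assoc (star A), ← mul_assoc, nonsing_inv_mul _ hA', one_mul]
      have h6 : u⁻¹.1 * (star A)⁻¹ = A * u⁻¹.1 := by
        rw [Units.inv_mul_eq_iff_eq_mul, ← mul_assoc, hPA, mul_assoc, Units.mul_inv, mul_one]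
      rw [mul_assoc, h5, ← mul_assoc, h6, mul_assoc]
    have hne : u⁻¹.1 * H ≠ 0 := by
      rw [hH]
      exact fun h => hc (by simpa using congrArg (u.1 * ·) h)
    have := u.isUnit.mul (isUnit_of_commute hirr hcomm hne)
    rwa [← mul_assoc, Units.mul_inv, one_mul] at this

theorem IsSelfDual.isIsometryCharpoly [Finite F] {d : F} (hd : star d ≠ d) {f : F[X]}
    (hf : IsSelfDual f) : IsIsometryCharpoly f := by
  induction hN : f.natDegree using Nat.strong_induction_on generalizing f with
  | _ N ih =>
    subst hN
    have hstep : ∀ {r g : F[X]}, IsSelfDual r → IsIsometryCharpoly r → 0 < r.natDegree →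
        f = r * g → IsIsometryCharpoly f := by
      intro r g hr hr' hdeg hrg
      have hg : IsSelfDual g := hr.of_mul (hrg ▸ hf)
      rw [hrg]
      refine hr'.mul (ih g.natDegree ?_ hg rfl)
      rw [hrg, hr.1.natDegree_mul hg.1]
      omega
    by_cases hunit : IsUnit f
    · rw [hf.1.eq_one_of_isUnit hunit]
      exact isIsometryCharpoly_one
    obtain ⟨p, hp, hirr, g, hg⟩ := exists_monic_irreducible_factor f hunit
    have h0 : p.coeff 0 ≠ 0 := by
      have := hf.coeff_zero_ne_zero
      rw [hg, mul_coeff_zero] at this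
      exact left_ne_zero_of_mul this
    by_cases hself : conjDual p = p
    · exact hstep ⟨hp, hself⟩ (isIsometryCharpoly_of_irreducible hd ⟨hp, hself⟩ hirr)
        hirr.natDegree_pos hg
    · have hirr' := irreducible_conjDual hp h0 hirr
      have hcop : IsCoprime p (conjDual p) := by
        refine (hirr.coprime_iff_not_dvd).2 fun hdvd => hself ?_
        exact (eq_of_monic_of_associated hp (monic_conjDual h0)
          (hirr.associated_of_dvd hirr' hdvd)).symm
      have hdvd : conjDual p ∣ f := ⟨conjDual g, by rw [← conjDual_mul, ← hg, hf.2]⟩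
      obtain ⟨k, hk⟩ := hcop.mul_dvd ⟨g, hg⟩ hdvd
      refine hstep (isSelfDual_mul_conjDual hp h0) (isIsometryCharpoly_mul_conjDual hp h0) ?_ hk
      rw [hp.natDegree_mul (monic_conjDual h0)]
      have := hirr.natDegree_pos
      omega

open Matrix in
theorem IsIsometryCharpoly.exists_unitary [Finite F] {d : F} (hd : star d ≠ d) {f : F[X]}
    (hf : IsIsometryCharpoly f) {n : ℕ} (hn : f.natDegree = n) :
    ∃ U : unitaryGroup (Fin n) F, (U : Matrix (Fin n) (Fin n) F).charpoly = f := by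
  obtain ⟨ι, _, _, A, H, hH, hu, hA, rfl⟩ := hf
  rw [charpoly_natDegree_eq_dim] at hn
  obtain ⟨Q, -, hQ⟩ := exists_star_mul_self_eq d hd H hH hu
  have hQu : IsUnit Q := by
    rw [isUnit_iff_isUnit_det] at hu ⊢
    rw [← hQ, det_mul] at hu
    exact isUnit_of_mul_isUnit_right hu
  obtain ⟨u, rfl⟩ := hQu
  have hU : star (u.1 * A * u⁻¹.1) * (u.1 * A * u⁻¹.1) = 1 := by
    have h1 : star u⁻¹.1 * star u.1 = 1 := by rw [← star_mul, Units.mul_inv, star_one]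
    calc star (u.1 * A * u⁻¹.1) * (u.1 * A * u⁻¹.1)
        = star u⁻¹.1 * (star A * (star u.1 * u.1) * A) * u⁻¹.1 := by
          simp only [star_mul, mul_assoc]
      _ = (star u⁻¹.1 * star u.1) * (u.1 * u⁻¹.1) := by
          rw [hQ, hA, ← hQ]
          simp only [mul_assoc]
      _ = 1 := by rw [h1, Units.mul_inv, one_mul]
  let e := Fintype.equivFinOfCardEq hn
  refine ⟨⟨reindex e e (u.1 * A * u⁻¹.1), mem_unitaryGroup_iff'.2 ?_⟩, ?_⟩
  · rw [reindex_apply, star_eq_conjTranspose, conjTranspose_submatrix, submatrix_mul_equiv,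
      ← star_eq_conjTranspose, hU, submatrix_one_equiv]
  · rw [charpoly_reindex, coe_units_inv, charpoly_units_conj]

theorem card_isSelfDual_le_card_conjClasses [Finite F] {d : F} (hd : star d ≠ d) (n : ℕ) :
    Nat.card {f : F[X] // IsSelfDual f ∧ f.natDegree = n} ≤
      Nat.card (ConjClasses (Matrix.unitaryGroup (Fin n) F)) := by
  have h : ∀ f : {f : F[X] // IsSelfDual f ∧ f.natDegree = n},
      ∃ U : Matrix.unitaryGroup (Fin n) F, (U : Matrix (Fin n) (Fin n) F).charpoly = f.1 :=
    fun f => (f.2.1.isIsometryCharpoly hd).exists_unitary hd f.2.2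
  choose U hU using h
  have : Finite (ConjClasses (Matrix.unitaryGroup (Fin n) F)) := Quotient.finite _
  refine Nat.card_le_card_of_injective (fun f => ConjClasses.mk (U f)) fun f g hfg => ?_
  obtain ⟨c, hc⟩ := isConj_iff.1 (ConjClasses.mk_eq_mk_iff_isConj.1 hfg)
  refine Subtype.ext ?_
  rw [← hU f, ← hU g, ← hc]
  have h1 := Matrix.charpoly_units_conj (Unitary.toUnits c) (U f : Matrix (Fin n) (Fin n) F)
  rw [← Matrix.coe_units_inv] at h1
  exact h1.symm

end

end

/-- Proposition 3.11(2): `q^n + q^{n-1} ≤ k(GU(n,q)) ≤ q^n + 16 q^{n-1}`, and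
`k(GU(n,q)) ≤ q^n + 7 q^{n-1}` for `q ≥ 3`.  Here the unitary group is taken with
respect to the star operation `x ↦ x^q` on a field with `q²` elements. -/
theorem stmt_10 (q : ℕ) (hq : IsPrimePow q)
    (F : Type*) [Field F] [Fintype F] [StarRing F]
    (hF : Fintype.card F = q ^ 2) (hstar : ∀ x : F, star x = x ^ q)
    (n : ℕ) (hn : 1 ≤ n) :
    (q ^ n + q ^ (n - 1) ≤ Nat.card (ConjClasses (Matrix.unitaryGroup (Fin n) F)) ∧
      Nat.card (ConjClasses (Matrix.unitaryGroup (Fin n) F)) ≤ q ^ n + 16 * q ^ (n - 1)) ∧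
    (3 ≤ q →
      Nat.card (ConjClasses (Matrix.unitaryGroup (Fin n) F)) ≤ q ^ n + 7 * q ^ (n - 1)) := by
  obtain ⟨k, rfl⟩ : ∃ k, n = k + 1 := ⟨n - 1, by omega⟩
  have hq1 : 1 < q := hq.one_lt
  rw [Nat.add_sub_cancel]
  obtain ⟨d, hd⟩ := exists_star_ne hq1 hF hstar
  have hlower : q ^ (k + 1) + q ^ k ≤
      Nat.card (ConjClasses (Matrix.unitaryGroup (Fin (k + 1)) F)) := by
    have h := card_isSelfDual_le_card_conjClasses hd (k + 1)
    rw [card_isSelfDual_succ hq1 hF hstar] at h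
    exact le_of_eq_of_le (by ring) h
  have hupper := card_conjClasses_le hq1 hF hstar k
  have hthree : 3 ≤ q → Nat.card (ConjClasses (Matrix.unitaryGroup (Fin (k + 1)) F)) ≤
      q ^ (k + 1) + 7 * q ^ k := by
    intro h3
    have h3' : (3 : ℝ) ≤ q := by exact_mod_cast h3
    have hle := hupper.trans (mul_le_mul_of_nonneg_left (prod_le_of_three_le h3' k)
      (by positivity))
    have heq : (q : ℝ) ^ (k + 1) * (1 + 7 / q) = q ^ (k + 1) + 7 * q ^ k := by
      have : (q : ℝ) ≠ 0 := by positivity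
      field_simp
      ring
    rw [heq] at hle
    exact_mod_cast hle
  refine ⟨⟨hlower, ?_⟩, hthree⟩
  rcases Nat.lt_or_ge 2 q with h3 | h2
  · exact (hthree h3).trans (by gcongr; norm_num)
  · obtain rfl : q = 2 := by omega
    have hle := hupper.trans (mul_le_mul_of_nonneg_left (prod_le_nine k) (by positivity))
    have heq : ((2 : ℕ) : ℝ) ^ (k + 1) * 9 = 2 ^ (k + 1) + 16 * 2 ^ k := by
      push_cast
      ring
    rw [heq] at hle
    exact_mod_cast hle
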